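/- arXiv:1906.06259 — 2 statements merged into one kernel-verified Lean document; each statement's English description precedes it below -/
import Mathlib

section
/- Let n ≥ 4 be odd, n = 2k + 1, and let G = C_{2n}(2, n) be the cubic circulant graph on 2n vertices with connection set {2, n}. Then the edge ideal I(G) satisfies reg(I(G)) ≤ k + 1 if k is even, and reg(I(G)) ≤ k + 2 if k is odd. -/
/-- The faces of cardinality `m` of a simplicial complex, given as a finite
family of finite subsets of `Fin n`. -/
def cfaces {n : ℕ} (Δ : Finset (Finset (Fin n))) (m : ℕ) : Finset (Finset (Fin n)) :=
  Δ.filter (fun F => F.card = m)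

/-- The coefficient of the face `G` in the simplicial boundary of the face `F`
(with respect to the linear order on the vertices `Fin n`). -/
noncomputable def bcoeff (K : Type*) [Field K] {n : ℕ} (F G : Finset (Fin n)) : K :=
  ∑ v ∈ F, if F.erase v = G then (-1 : K) ^ (F.filter (fun w => w < v)).card else 0

/-- The simplicial boundary map from chains spanned by faces of cardinality `m+1`
to chains spanned by faces of cardinality `m` (so the augmentation map
corresponds to `m = 0`). -/
noncomputable def boundaryMap (K : Type*) [Field K] {n : ℕ}
    (Δ : Finset (Finset (Fin n))) (m : ℕ) :
    ({F // F ∈ cfaces Δ (m + 1)} → K) →ₗ[K] ({G // G ∈ cfaces Δ m} → K) :=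
  LinearMap.pi fun G => ∑ F : {F // F ∈ cfaces Δ (m + 1)}, bcoeff K F.1 G.1 • LinearMap.proj F

/-- The dimension over `K` of the `i`-th reduced simplicial homology of the
simplicial complex `Δ` (using the augmented chain complex, so that
`i = -1` is allowed). -/
noncomputable def reducedHomologyRank (K : Type*) [Field K] {n : ℕ}
    (Δ : Finset (Finset (Fin n))) (i : ℤ) : ℕ :=
  if i = -1 then
    Module.finrank K (({F // F ∈ cfaces Δ 0} → K) ⧸ LinearMap.range (boundaryMap K Δ 0))
  else if 0 ≤ i then
    Module.finrank K
      (↥(LinearMap.ker (boundaryMap K Δ i.toNat)) ⧸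
        Submodule.comap (LinearMap.ker (boundaryMap K Δ i.toNat)).subtype
          (LinearMap.range (boundaryMap K Δ (i.toNat + 1))))
  else 0

/-- The graded Betti numbers `β_{i,j}` of the Stanley–Reisner ideal of the
simplicial complex `Δ` over the field `K`, defined via Hochster's formula:
`β_{i,j} = ∑_{|W| = j} dim_K H̃_{j-i-2}(Δ_W; K)`. -/
noncomputable def bettiNumber (K : Type*) [Field K] {n : ℕ}
    (Δ : Finset (Finset (Fin n))) (i j : ℕ) : ℕ :=
  ∑ W ∈ Finset.powersetCard j (Finset.univ : Finset (Fin n)),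
    reducedHomologyRank K (Δ.filter (fun F => F ⊆ W)) ((j : ℤ) - (i : ℤ) - 2)

/-- The Castelnuovo–Mumford regularity `reg(I) = max { j - i | β_{i,j}(I) ≠ 0 }`
of the Stanley–Reisner ideal of `Δ` over `K`. -/
noncomputable def regSR (K : Type*) [Field K] {n : ℕ} (Δ : Finset (Finset (Fin n))) : ℕ :=
  sSup {d : ℕ | ∃ i j : ℕ, bettiNumber K Δ i j ≠ 0 ∧ (j : ℤ) - (i : ℤ) = d}

/-- The projective dimension `pd(I) = max { i | β_{i,j}(I) ≠ 0 for some j }`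
of the Stanley–Reisner ideal of `Δ` over `K`. -/
noncomputable def pdSR (K : Type*) [Field K] {n : ℕ} (Δ : Finset (Finset (Fin n))) : ℕ :=
  sSup {i : ℕ | ∃ j : ℕ, bettiNumber K Δ i j ≠ 0}

/-- The reduced Euler characteristic `χ̃(Δ) = ∑_{F ∈ Δ} (-1)^{|F| - 1}`
of a simplicial complex `Δ` (the alternating sum of the `f`-vector). -/
def eulerCharSR {n : ℕ} (Δ : Finset (Finset (Fin n))) : ℤ :=
  ∑ F ∈ Δ, (-1 : ℤ) ^ (F.card + 1)

/-- The circulant graph `C_n(S)`: the graph on the vertex set `ZMod n`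
(identified with `{x_1, …, x_n}`) in which `x` and `y` are adjacent if and only
if they differ by `±s (mod n)` for some `s ∈ S`. -/
def circulant (n : ℕ) (S : Set ℕ) : SimpleGraph (ZMod n) :=
  SimpleGraph.fromRel (fun x y => ∃ s ∈ S, y - x = (s : ZMod n))

/-- A graph is chordal if it has no induced cycle of length `m ≥ 4`.  Here an
induced `m`-cycle is an injection of the cycle `C_m = C_m(1)` whose image
induces exactly the cycle's adjacency. -/
def IsChordal {V : Type*} (G : SimpleGraph V) : Prop :=
  ∀ m : ℕ, 4 ≤ m → ¬ ∃ f : ZMod m → V, Function.Injective f ∧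
    ∀ a b : ZMod m, G.Adj (f a) (f b) ↔ (circulant m {1}).Adj a b

/-- A graph is claw-free if it has no induced subgraph isomorphic to the claw
`K_{1,3}`, i.e. there is no vertex adjacent to three pairwise non-adjacent
vertices. -/
def ClawFree {V : Type*} (G : SimpleGraph V) : Prop :=
  ¬ ∃ c x y z : V, x ≠ y ∧ x ≠ z ∧ y ≠ z ∧
    G.Adj c x ∧ G.Adj c y ∧ G.Adj c z ∧ ¬ G.Adj x y ∧ ¬ G.Adj x z ∧ ¬ G.Adj y z

open Classical in
/-- The independence complex `Ind(G)` of a finite simple graph `G`, recorded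
as a simplicial complex on `Fin (card V)` via a fixed identification of the
vertices with `Fin (card V)`.  It is the Stanley–Reisner complex of the edge
ideal `I(G)`. -/
noncomputable def indComplex {V : Type*} [Fintype V] (G : SimpleGraph V) :
    Finset (Finset (Fin (Fintype.card V))) :=
  Finset.univ.filter (fun F : Finset (Fin (Fintype.card V)) =>
    ∀ u ∈ F, ∀ v ∈ F,
      ¬ G.Adj ((Fintype.equivFin V).symm u) ((Fintype.equivFin V).symm v))

/-- The Castelnuovo–Mumford regularity `reg(I(G))` of the edge ideal of the
finite simple graph `G` over the field `K`, computed (via Hochster's formula)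
from the independence complex of `G`. -/
noncomputable def regEdgeIdeal (K : Type*) [Field K] {V : Type*} [Fintype V]
    (G : SimpleGraph V) : ℕ :=
  regSR K (indComplex G)

/-- The projective dimension `pd(I(G))` of the edge ideal of the finite simple
graph `G` over the field `K`, computed (via Hochster's formula) from the
independence complex of `G`. -/
noncomputable def pdEdgeIdeal (K : Type*) [Field K] {V : Type*} [Fintype V]
    (G : SimpleGraph V) : ℕ :=
  pdSR K (indComplex G)

/-- The sign `(-1) ^ #{w ∈ F | w < v}` of the position of `v` relative to `F`. -/
def posSign (K : Type*) [Field K] {N : ℕ} (v : Fin N) (F : Finset (Fin N)) : K :=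
  (-1 : K) ^ (F.filter (fun w => w < v)).card

/-- The simplicial boundary on all functions `Finset (Fin N) → K`. -/
def fullBoundary (K : Type*) [Field K] {N : ℕ} (c : Finset (Fin N) → K) : Finset (Fin N) → K :=
  fun G => ∑ v ∈ Gᶜ, posSign K v G * c (insert v G)

/-- The cone operator `c ↦ x * c` on functions `Finset (Fin N) → K`. -/
def coneChain (K : Type*) [Field K] {N : ℕ} (x : Fin N) (c : Finset (Fin N) → K) :
    Finset (Fin N) → K :=
  fun F => if x ∈ F then posSign K x F * c (F.erase x) else 0

/-- The link part of a chain with respect to the vertex `x`. -/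
def linkChain (K : Type*) [Field K] {N : ℕ} (x : Fin N) (c : Finset (Fin N) → K) :
    Finset (Fin N) → K :=
  fun F => if x ∈ F then 0 else posSign K x F * c (insert x F)

section Signs

variable {K : Type*} [Field K] {N : ℕ}

lemma posSign_insert_of_le {v x : Fin N} (h : v ≤ x) (F : Finset (Fin N)) :
    posSign K v (insert x F) = posSign K v F := by
  unfold posSign
  rw [Finset.filter_insert, if_neg (not_lt.mpr h)]

lemma posSign_insert_of_lt {v x : Fin N} (h : x < v) {F : Finset (Fin N)} (hx : x ∉ F) :
    posSign K v (insert x F) = - posSign K v F := by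
  unfold posSign
  rw [Finset.filter_insert, if_pos h, Finset.card_insert_of_notMem (by simp [hx]), pow_succ]
  ring

lemma posSign_mul_self (v : Fin N) (F : Finset (Fin N)) :
    posSign K v F * posSign K v F = 1 := by
  unfold posSign
  rw [← mul_pow]; simp

lemma posSign_swap {v x : Fin N} (hvx : v ≠ x) {G : Finset (Fin N)} (hv : v ∉ G) (hx : x ∉ G) :
    posSign K v (insert x G) * posSign K x (insert v G) = - (posSign K x G * posSign K v G) := by
  rcases lt_or_gt_of_ne hvx with h | h
  · rw [posSign_insert_of_le h.le, posSign_insert_of_lt h hv]; ring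
  · rw [posSign_insert_of_le h.le, posSign_insert_of_lt h hx]; ring

lemma fullBoundary_coneChain_add (x : Fin N) (c : Finset (Fin N) → K) :
    fullBoundary K (coneChain K x c) + coneChain K x (fullBoundary K c) = c := by
  funext G
  simp only [Pi.add_apply, fullBoundary, coneChain]
  by_cases hx : x ∈ G
  · obtain ⟨H, hH, rfl⟩ : ∃ H, x ∉ H ∧ G = insert x H :=
      ⟨G.erase x, by simp, by simp [Finset.insert_erase hx]⟩
    have hc : Hᶜ = insert x (insert x H)ᶜ := by
      ext a; by_cases a = x <;> simp_all
    rw [if_pos hx, Finset.erase_insert hH, hc, Finset.sum_insert (by simp), mul_add, ← mul_assoc,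
      posSign_insert_of_le le_rfl, posSign_mul_self, one_mul, add_left_comm, Finset.mul_sum,
      ← Finset.sum_add_distrib, Finset.sum_eq_zero, add_zero]
    intro v hv
    simp only [Finset.mem_compl, Finset.mem_insert, not_or] at hv
    rw [if_pos (by simp), Finset.insert_comm, posSign_insert_of_le le_rfl,
      Finset.erase_insert (by simp [hH, Ne.symm hv.1]), ← mul_assoc, posSign_swap hv.1 hv.2 hH]
    ring
  · rw [if_neg hx, add_zero, Finset.sum_eq_single x]
    · rw [if_pos (by simp), Finset.erase_insert hx, posSign_insert_of_le le_rfl, ← mul_assoc,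
        posSign_mul_self, one_mul]
    · intro v _ hv
      rw [if_neg (by simp [hx, Ne.symm hv]), mul_zero]
    · intro h; exact absurd (Finset.mem_compl.mpr hx) h

lemma fullBoundary_linkChain (x : Fin N) (c : Finset (Fin N) → K) :
    fullBoundary K (linkChain K x c) = - linkChain K x (fullBoundary K c) := by
  funext G
  simp only [Pi.neg_apply, fullBoundary, linkChain]
  by_cases hx : x ∈ G
  · simp [hx]
  · have hc : Gᶜ = insert x (insert x G)ᶜ := by
      ext a; by_cases a = x <;> simp_all
    rw [if_neg hx, hc, Finset.sum_insert (by simp), if_pos (by simp), mul_zero, zero_add,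
      Finset.mul_sum, ← Finset.sum_neg_distrib]
    refine Finset.sum_congr rfl fun v hv => ?_
    simp only [Finset.mem_compl, Finset.mem_insert, not_or] at hv
    rw [if_neg (by simp [hx, Ne.symm hv.1]), Finset.insert_comm, ← mul_assoc, ← mul_assoc,
      mul_comm (posSign K x G), ← neg_mul, mul_comm (posSign K v G) (posSign K x (insert v G))]
    congr 1
    rcases lt_or_gt_of_ne hv.1 with h | h
    · rw [posSign_insert_of_le h.le, posSign_insert_of_lt h hv.2]; ring
    · rw [posSign_insert_of_le h.le, posSign_insert_of_lt h hx]; ring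

lemma fullBoundary_add (c d : Finset (Fin N) → K) :
    fullBoundary K (c + d) = fullBoundary K c + fullBoundary K d := by
  funext G
  simp [fullBoundary, mul_add, Finset.sum_add_distrib]

lemma fullBoundary_sub (c d : Finset (Fin N) → K) :
    fullBoundary K (c - d) = fullBoundary K c - fullBoundary K d := by
  funext G
  simp [fullBoundary, mul_sub, Finset.sum_sub_distrib]

lemma coneChain_zero (x : Fin N) : coneChain K x 0 = 0 := by
  funext G; simp [coneChain]

lemma fullBoundary_coneChain (x : Fin N) (c : Finset (Fin N) → K) :
    fullBoundary K (coneChain K x c) = c - coneChain K x (fullBoundary K c) :=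
  eq_sub_of_add_eq (fullBoundary_coneChain_add x c)

end Signs

/-- `D` has no reduced homology in dimension `m`, in terms of chains extended by zero. -/
def AcyclicAt (K : Type*) [Field K] {N : ℕ} (D : Finset (Fin N) → Prop) (m : ℕ) : Prop :=
  ∀ z : Finset (Fin N) → K, (∀ F, z F ≠ 0 → D F ∧ F.card = m + 1) → fullBoundary K z = 0 →
    ∃ w : Finset (Fin N) → K, (∀ F, w F ≠ 0 → D F ∧ F.card = m + 2) ∧ fullBoundary K w = z

/-- `F` is an independent set of `G` contained in `W`. -/
def IndepIn {N : ℕ} (G : SimpleGraph (Fin N)) (W : Set (Fin N)) (F : Finset (Fin N)) : Prop :=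
  (∀ u ∈ F, u ∈ W) ∧ ∀ u ∈ F, ∀ v ∈ F, ¬ G.Adj u v

/-- All induced subcomplexes of `Ind(G)` on subsets of `S` are acyclic in dimensions `≥ d`. -/
def HomologyVanishes (K : Type*) [Field K] {N : ℕ} (G : SimpleGraph (Fin N))
    (S : Set (Fin N)) (d : ℕ) : Prop :=
  ∀ W ⊆ S, ∀ m, d ≤ m → AcyclicAt K (IndepIn G W) m

section Homology

variable {K : Type*} [Field K] {N : ℕ} {G : SimpleGraph (Fin N)}

lemma AcyclicAt.cone {W : Set (Fin N)} {x : Fin N} (hx : x ∈ W) (hiso : ∀ y ∈ W, ¬ G.Adj x y)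
    (m : ℕ) : AcyclicAt K (IndepIn G W) m := by
  intro z hz hdz
  refine ⟨coneChain K x z, fun F hF => ?_, ?_⟩
  · by_cases hxF : x ∈ F
    · rw [coneChain, if_pos hxF] at hF
      obtain ⟨⟨h1, h2⟩, h3⟩ := hz _ (right_ne_zero_of_mul hF)
      have key : ∀ u ∈ F, u ≠ x → u ∈ F.erase x := fun u hu hne => by simp [hu, hne]
      have hW : ∀ u ∈ F, u ∈ W := fun u hu => by
        by_cases hux : u = x
        · rwa [hux]
        · exact h1 u (key u hu hux)
      refine ⟨⟨hW, fun u hu v hv => ?_⟩, ?_⟩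
      · by_cases hux : u = x
        · rw [hux]; exact hiso v (hW v hv)
        · by_cases hvx : v = x
          · rw [hvx, G.adj_comm]; exact hiso u (hW u hu)
          · exact h2 u (key u hu hux) v (key v hv hvx)
      · rw [Finset.card_erase_of_mem hxF] at h3; omega
    · simp [coneChain, hxF] at hF
  · rw [fullBoundary_coneChain, hdz, coneChain_zero, sub_zero]

lemma AcyclicAt.of_deletion_link {W : Set (Fin N)} {x : Fin N} (hx : x ∈ W) {m : ℕ}
    (hdel : AcyclicAt K (IndepIn G (W \ {x})) (m + 1))
    (hlink : AcyclicAt K (IndepIn G (W \ {y | y = x ∨ G.Adj x y})) m) :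
    AcyclicAt K (IndepIn G W) (m + 1) := by
  intro z hz hdz
  obtain ⟨w, hw, hdw⟩ := hlink (linkChain K x z) (fun F hF => by
      by_cases hxF : x ∈ F
      · simp [linkChain, hxF] at hF
      · rw [linkChain, if_neg hxF] at hF
        obtain ⟨⟨h1, h2⟩, h3⟩ := hz _ (right_ne_zero_of_mul hF)
        rw [Finset.card_insert_of_notMem hxF] at h3
        refine ⟨⟨fun u hu => ⟨h1 u (by simp [hu]), ?_⟩,
          fun u hu v hv => h2 u (by simp [hu]) v (by simp [hv])⟩, by omega⟩
        rintro (rfl | h)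
        · exact hxF hu
        · exact h2 x (by simp) u (by simp [hu]) h)
    (by
      rw [fullBoundary_linkChain, hdz]
      funext F; simp [linkChain])
  have hdl : fullBoundary K (linkChain K x z) = 0 := by
    rw [fullBoundary_linkChain, hdz]
    funext F; simp [linkChain]
  obtain ⟨u, hu, hdu⟩ := hdel (z - coneChain K x (linkChain K x z) + w) (fun F hF => by
      by_cases hxF : x ∈ F
      · exfalso
        apply hF
        have hwF : w F = 0 := by
          by_contra h
          exact ((hw F h).1.1 x hxF).2 (Or.inl rfl)
        simp only [Pi.add_apply, Pi.sub_apply, coneChain, linkChain, if_pos hxF, hwF,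
          Finset.notMem_erase, if_false, Finset.insert_erase hxF]
        rw [← mul_assoc, ← posSign_insert_of_le le_rfl (F.erase x), Finset.insert_erase hxF,
          posSign_mul_self]
        ring
      · have hc : coneChain K x (linkChain K x z) F = 0 := by simp [coneChain, hxF]
        simp only [Pi.add_apply, Pi.sub_apply, hc, sub_zero] at hF
        have hsub : ∀ u ∈ F, u ∉ ({x} : Set (Fin N)) := fun u hu h => hxF (by
          rw [Set.mem_singleton_iff] at h; rwa [← h])
        by_cases hzF : z F = 0
        · rw [hzF, zero_add] at hF
          obtain ⟨⟨h1, h2⟩, h3⟩ := hw F hF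
          exact ⟨⟨fun u hu => ⟨(h1 u hu).1, hsub u hu⟩, h2⟩, by omega⟩
        · obtain ⟨⟨h1, h2⟩, h3⟩ := hz F hzF
          exact ⟨⟨fun u hu => ⟨h1 u hu, hsub u hu⟩, h2⟩, h3⟩)
    (by
      rw [fullBoundary_add, fullBoundary_sub, fullBoundary_coneChain, hdl, coneChain_zero, hdw, hdz]
      simp)
  refine ⟨u - coneChain K x w, fun F hF => ?_, ?_⟩
  · by_cases huF : u F = 0
    · simp only [Pi.sub_apply, huF, zero_sub, ne_eq, neg_eq_zero] at hF
      by_cases hxF : x ∈ F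
      · rw [coneChain, if_pos hxF] at hF
        obtain ⟨⟨h1, h2⟩, h3⟩ := hw _ (right_ne_zero_of_mul hF)
        have key : ∀ u ∈ F, u ≠ x → u ∈ F.erase x := fun u hu hne => by simp [hu, hne]
        rw [Finset.card_erase_of_mem hxF] at h3
        refine ⟨⟨fun u hu => ?_, fun u hu v hv => ?_⟩, by omega⟩
        · by_cases hux : u = x
          · rwa [hux]
          · exact (h1 u (key u hu hux)).1
        · by_cases hux : u = x
          · by_cases hvx : v = x
            · rw [hux, hvx]; exact G.irrefl
            · rw [hux]; exact fun h => (h1 v (key v hv hvx)).2 (Or.inr h)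
          · by_cases hvx : v = x
            · rw [hvx]; exact fun h => (h1 u (key u hu hux)).2 (Or.inr h.symm)
            · exact h2 u (key u hu hux) v (key v hv hvx)
      · simp [coneChain, hxF] at hF
    · obtain ⟨⟨h1, h2⟩, h3⟩ := hu F huF
      exact ⟨⟨fun u hu => (h1 u hu).1, h2⟩, h3⟩
  · rw [fullBoundary_sub, hdu, fullBoundary_coneChain, hdw]
    abel

lemma HomologyVanishes.mono {S T : Set (Fin N)} {d e : ℕ} (h : HomologyVanishes K G T d)
    (hST : S ⊆ T) (hde : d ≤ e) : HomologyVanishes K G S e :=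
  fun W hW m hm => h W (hW.trans hST) m (hde.trans hm)

lemma HomologyVanishes.empty : HomologyVanishes K G ∅ 0 := by
  intro W hW m _ z hz _
  have hz0 : z = 0 := by
    funext F
    by_contra hF
    obtain ⟨⟨h1, -⟩, h2⟩ := hz F hF
    obtain ⟨u, hu⟩ := Finset.card_pos.mp (by omega : 0 < F.card)
    exact hW (h1 u hu)
  exact ⟨0, fun F hF => absurd rfl hF, by rw [hz0]; funext F; simp [fullBoundary]⟩

lemma HomologyVanishes.of_isolated {S : Set (Fin N)} {d : ℕ} (x : Fin N)
    (hiso : ∀ y ∈ S, ¬ G.Adj x y) (h : HomologyVanishes K G (S \ {x}) d) :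
    HomologyVanishes K G S d := by
  intro W hW m hm
  by_cases hx : x ∈ W
  · exact AcyclicAt.cone hx (fun y hy => hiso y (hW hy)) m
  · exact h W (fun y hy => ⟨hW hy, fun hyx => hx (by rwa [← Set.mem_singleton_iff.mp hyx])⟩) m hm

lemma HomologyVanishes.of_deletion_link {S : Set (Fin N)} {d : ℕ} (x : Fin N)
    (hdel : HomologyVanishes K G (S \ {x}) (d + 1))
    (hlink : HomologyVanishes K G (S \ {y | y = x ∨ G.Adj x y}) d) :
    HomologyVanishes K G S (d + 1) := by
  intro W hW m hm
  by_cases hx : x ∈ W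
  · obtain ⟨m, rfl⟩ : ∃ m', m = m' + 1 := ⟨m - 1, by omega⟩
    exact AcyclicAt.of_deletion_link hx (hdel _ (Set.sdiff_subset_sdiff_left hW) _ hm)
      (hlink _ (Set.sdiff_subset_sdiff_left hW) _ (by omega))
  · exact hdel W (fun y hy => ⟨hW hy, fun hyx => hx (by rwa [← Set.mem_singleton_iff.mp hyx])⟩) m hm

end Homology

section Bridge

variable {K : Type*} [Field K] {N : ℕ}

lemma fullBoundary_apply_eq_sum_bcoeff (c : Finset (Fin N) → K) (G : Finset (Fin N)) :
    fullBoundary K c G = ∑ F, bcoeff K F G * c F := by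
  have h : ∀ F, bcoeff K F G * c F =
      ∑ v, if v ∉ G ∧ F = insert v G then posSign K v G * c (insert v G) else 0 := by
    intro F
    rw [bcoeff, Finset.sum_mul, ← Finset.sum_subset (Finset.subset_univ F)]
    · refine Finset.sum_congr rfl fun v hv => ?_
      by_cases hF : F.erase v = G
      · have h1 : v ∉ G := by rw [← hF]; simp
        have h2 : F = insert v G := by rw [← hF, Finset.insert_erase hv]
        rw [if_pos hF, if_pos ⟨h1, h2⟩, ← posSign_insert_of_le le_rfl G, ← h2]
        rfl
      · rw [if_neg hF, if_neg, zero_mul]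
        rintro ⟨h1, rfl⟩
        exact hF (Finset.erase_insert h1)
    · intro v _ hv
      rw [if_neg]
      rintro ⟨-, rfl⟩
      simp at hv
  simp_rw [h]
  rw [Finset.sum_comm, fullBoundary, ← Finset.sum_subset (Finset.subset_univ Gᶜ)]
  · refine Finset.sum_congr rfl fun v hv => ?_
    simp only [Finset.mem_compl] at hv
    simp [hv]
  · intro v _ hv
    simp only [Finset.mem_compl, not_not] at hv
    simp [hv]

lemma boundaryMap_apply_eq_fullBoundary (Δ : Finset (Finset (Fin N))) (m : ℕ)
    (c : Finset (Fin N) → K) (hc : ∀ F, c F ≠ 0 → F ∈ cfaces Δ (m + 1))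
    (G : {G // G ∈ cfaces Δ m}) :
    boundaryMap K Δ m (fun F => c F.1) G = fullBoundary K c G.1 := by
  rw [fullBoundary_apply_eq_sum_bcoeff, ← Finset.sum_subset (Finset.subset_univ (cfaces Δ (m + 1)))]
  · rw [← Finset.sum_coe_sort]
    simp [boundaryMap]
  · intro F _ hF
    have : c F = 0 := by
      by_contra h
      exact hF (hc F h)
    rw [this, mul_zero]

lemma reducedHomologyRank_eq_zero (Δ : Finset (Finset (Fin N)))
    (hΔ : ∀ F ∈ Δ, ∀ G ⊆ F, G ∈ Δ) (m : ℕ) (h : AcyclicAt K (· ∈ Δ) m) :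
    reducedHomologyRank K Δ m = 0 := by
  rw [reducedHomologyRank, if_neg (by omega), if_pos (by omega), Int.toNat_natCast]
  have htop : Submodule.comap (LinearMap.ker (boundaryMap K Δ m)).subtype
      (LinearMap.range (boundaryMap K Δ (m + 1))) = ⊤ := by
    rw [eq_top_iff]
    rintro ⟨z, hz⟩ -
    rw [LinearMap.mem_ker] at hz
    rw [Submodule.mem_comap, LinearMap.mem_range]
    set c : Finset (Fin N) → K := fun F => if hF : F ∈ cfaces Δ (m + 1) then z ⟨F, hF⟩ else 0
      with hcdef
    have hc : ∀ F, c F ≠ 0 → F ∈ cfaces Δ (m + 1) := fun F hF => by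
      by_contra hn
      simp [hcdef, hn] at hF
    have hcz : (fun F : {F // F ∈ cfaces Δ (m + 1)} => c F.1) = z := by
      funext F
      simp [hcdef, F.2]
    have hdc : fullBoundary K c = 0 := by
      funext G
      by_cases hG : G ∈ cfaces Δ m
      · rw [← boundaryMap_apply_eq_fullBoundary Δ m c hc ⟨G, hG⟩, hcz, hz]; rfl
      · refine Finset.sum_eq_zero fun v hv => ?_
        by_contra hne
        have hF := hc _ (right_ne_zero_of_mul hne)
        simp only [cfaces, Finset.mem_filter, Finset.mem_compl] at hF hv hG
        rw [Finset.card_insert_of_notMem hv] at hF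
        exact hG ⟨hΔ _ hF.1 _ (Finset.subset_insert v G), by omega⟩
    obtain ⟨w, hw, hdw⟩ := h c (fun F hF => by simpa [cfaces] using hc F hF) hdc
    refine ⟨fun F => w F.1, ?_⟩
    funext F
    rw [boundaryMap_apply_eq_fullBoundary Δ (m + 1) w (fun F hF => by
      simpa [cfaces] using hw F hF), hdw]
    simp [hcdef, F.2]
  rw [htop]
  have : Subsingleton (↥(LinearMap.ker (boundaryMap K Δ m)) ⧸
      (⊤ : Submodule K ↥(LinearMap.ker (boundaryMap K Δ m)))) :=
    Submodule.Quotient.subsingleton_iff.mpr rfl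
  exact Module.finrank_zero_of_subsingleton

lemma regEdgeIdeal_le {V : Type*} [Fintype V] (G : SimpleGraph V) (d : ℕ)
    (h : HomologyVanishes K (G.comap (Fintype.equivFin V).symm) Set.univ d) :
    regEdgeIdeal K G ≤ d + 1 := by
  refine csSup_le' ?_
  rintro e ⟨i, j, hne, he⟩
  by_contra! hlt
  apply hne
  refine Finset.sum_eq_zero fun W _ => ?_
  have hidx : (j : ℤ) - i - 2 = ((e - 2 : ℕ) : ℤ) := by omega
  rw [hidx]
  refine reducedHomologyRank_eq_zero _ ?_ _ ?_
  · intro F hF F' hF'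
    simp only [indComplex, Finset.mem_filter, Finset.mem_univ, true_and] at hF ⊢
    exact ⟨fun u hu v hv => hF.1 u (hF' hu) v (hF' hv), hF'.trans hF.2⟩
  · have hA := h (W : Set _) (Set.subset_univ _) (e - 2) (by omega)
    have hD : (IndepIn (G.comap (Fintype.equivFin V).symm) (W : Set _)) =
        (· ∈ (indComplex G).filter (fun F => F ⊆ W)) := by
      funext F
      simp only [IndepIn, indComplex, Finset.mem_filter, Finset.mem_univ, true_and,
        SimpleGraph.comap_adj, Finset.mem_coe, eq_iff_iff, Finset.subset_iff]
      exact and_comm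
    rwa [hD] at hA

end Bridge

/-- Adjacency in the infinite ladder with vertex set `ℕ × Bool`. -/
def LadderAdj (p q : ℕ × Bool) : Prop :=
  (p.2 = q.2 ∧ (p.1 + 1 = q.1 ∨ q.1 + 1 = p.1)) ∨ (p.2 ≠ q.2 ∧ p.1 = q.1)

/-- The rungs strictly after `p` and up to `e`, with the pendant vertex `(p, s)`. -/
def pendantLadder (s : Bool) (p e : ℕ) : Set (ℕ × Bool) :=
  {x | (x.1 = p ∧ x.2 = s) ∨ (p < x.1 ∧ x.1 ≤ e)}

/-- The rungs strictly between `p` and `e`, with pendant vertices `(p, s)` and `(e, t)`. -/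
def biPendantLadder (s t : Bool) (p e : ℕ) : Set (ℕ × Bool) :=
  {x | (x.1 = p ∧ x.2 = s) ∨ (p < x.1 ∧ x.1 < e) ∨ (x.1 = e ∧ x.2 = t)}

section Ladder

variable {K : Type*} [Field K] {N : ℕ} {G : SimpleGraph (Fin N)} {f : ℕ × Bool → Fin N}
  {a b : ℕ}

/-- `f` embeds the rungs `a, …, b` of the infinite ladder in `G` as an induced subgraph. -/
def IsLadderEmbedding {N : ℕ} (G : SimpleGraph (Fin N)) (f : ℕ × Bool → Fin N) (a b : ℕ) : Prop :=
  ∀ p q : ℕ × Bool, a ≤ p.1 → p.1 ≤ b → a ≤ q.1 → q.1 ≤ b →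
    (G.Adj (f p) (f q) ↔ LadderAdj p q)

/-- Deleting the neighbour `(p + 1, s)` of the pendant vertex `(p, s)` isolates the latter. -/
lemma HomologyVanishes.of_pendant (hf : IsLadderEmbedding G f a b) {T : Set (ℕ × Bool)}
    {p d : ℕ} {s : Bool} (hT : ∀ x ∈ T, p ≤ x.1 ∧ x.1 ≤ b) (hap : a ≤ p) (hpb : p < b)
    (hps : (p, !s) ∉ T)
    (hdel : HomologyVanishes K G (f '' (T \ {x | x = (p, s) ∨ x = (p + 1, s)})) (d + 1))
    (hlink : HomologyVanishes K G (f '' (T \ {x | x = (p + 1, s) ∨ LadderAdj (p + 1, s) x})) d) :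
    HomologyVanishes K G (f '' T) (d + 1) := by
  refine HomologyVanishes.of_deletion_link (f (p + 1, s)) ?_ ?_
  · refine HomologyVanishes.of_isolated (f (p, s)) ?_ (hdel.mono ?_ le_rfl)
    · rintro _ ⟨⟨⟨i, c⟩, hx, rfl⟩, hne⟩ hadj
      have hb := hT _ hx
      rw [hf _ _ hap hpb.le (hap.trans hb.1) hb.2] at hadj
      rcases hadj with ⟨h1, h2⟩ | ⟨h1, h2⟩
      · apply hne
        simp only at h1 h2 hb
        have : i = p + 1 := by omega
        simp [this, h1]
      · apply hps
        simp only at h1 h2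
        have : c = !s := by cases c <;> cases s <;> simp_all
        rw [← this, h2]; exact hx
    · rintro _ ⟨⟨⟨x, hx, rfl⟩, h1⟩, h2⟩
      refine ⟨x, ⟨hx, ?_⟩, rfl⟩
      rintro (rfl | rfl)
      · exact h2 rfl
      · exact h1 rfl
  · refine hlink.mono ?_ le_rfl
    rintro _ ⟨⟨x, hx, rfl⟩, h1⟩
    refine ⟨x, ⟨hx, ?_⟩, rfl⟩
    rintro (rfl | h)
    · exact h1 (Or.inl rfl)
    · have hb := hT _ hx
      exact h1 (Or.inr ((hf _ _ (by simp only; omega) (by simp only; omega)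
        (hap.trans hb.1) hb.2).mpr h))

lemma HomologyVanishes.singleton (x : Fin N) : HomologyVanishes K G {x} 0 :=
  HomologyVanishes.of_isolated x (by rintro y rfl; exact G.irrefl)
    (HomologyVanishes.empty.mono (by simp) le_rfl)

lemma HomologyVanishes.pendantLadder (hf : IsLadderEmbedding G f a b) (m : ℕ) :
    ∀ (s : Bool) (p : ℕ), a ≤ p → p + m ≤ b →
      HomologyVanishes K G (f '' (pendantLadder s p (p + m))) ((m + 1) / 2) := by
  induction m using Nat.strong_induction_on with
  | _ m ih =>
    intro s p hap hpb
    rcases m with _ | m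
    · refine (HomologyVanishes.singleton (f (p, s))).mono ?_ (by omega)
      rintro _ ⟨⟨i, c⟩, hx, rfl⟩
      have : (i, c) = (p, s) := by
        simp only [_root_.pendantLadder, Set.mem_ofPred_eq] at hx
        ext1 <;> simp <;> grind
      rw [this]; rfl
    · have hd : (m + 1 + 1) / 2 = m / 2 + 1 := by omega
      rw [hd]
      refine HomologyVanishes.of_pendant (p := p) (s := s) hf ?_ hap (by omega) ?_ ?_ ?_
      · rintro ⟨i, c⟩ hx
        simp only [_root_.pendantLadder, Set.mem_ofPred_eq] at hx
        simp only
        omega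
      · simp [_root_.pendantLadder]
      · refine (ih m (by omega) (!s) (p + 1) (by omega) (by omega)).mono (Set.image_mono ?_)
          (by omega)
        rintro ⟨i, c⟩ hx
        simp only [_root_.pendantLadder, Set.mem_ofPred_eq, Set.mem_sdiff, Prod.mk.injEq] at hx ⊢
        cases c <;> cases s <;> simp at hx ⊢ <;> omega
      · rcases m with _ | m
        · refine HomologyVanishes.empty.mono ?_ (by omega)
          rintro _ ⟨⟨i, c⟩, hx, rfl⟩
          simp only [_root_.pendantLadder, LadderAdj, Set.mem_ofPred_eq, Set.mem_sdiff,
            Prod.mk.injEq] at hx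
          exfalso
          cases c <;> cases s <;> simp at hx <;> omega
        · refine (ih m (by omega) (!s) (p + 2) (by omega) (by omega)).mono (Set.image_mono ?_)
            (by omega)
          rintro ⟨i, c⟩ hx
          simp only [_root_.pendantLadder, LadderAdj, Set.mem_ofPred_eq, Set.mem_sdiff,
            Prod.mk.injEq] at hx ⊢
          cases c <;> cases s <;> simp at hx ⊢ <;> omega

lemma HomologyVanishes.biPendantLadder (hf : IsLadderEmbedding G f a b) (m : ℕ) :
    ∀ (s t : Bool) (p : ℕ), a ≤ p → p + m + 1 ≤ b →
      HomologyVanishes K G (f '' (biPendantLadder s t p (p + m + 1))) (m / 2 + 1) ∧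
      (Even m → (s = t ↔ Odd (m / 2)) →
        HomologyVanishes K G (f '' (biPendantLadder s t p (p + m + 1))) (m / 2)) := by
  induction m using Nat.strong_induction_on with
  | _ m ih =>
    intro s t p hap hpb
    have hstep : ∀ d, HomologyVanishes K G (f '' (_root_.biPendantLadder s t p (p + m + 1) \
          {x | x = (p, s) ∨ x = (p + 1, s)})) (d + 1) →
        HomologyVanishes K G (f '' (_root_.biPendantLadder s t p (p + m + 1) \
          {x | x = (p + 1, s) ∨ LadderAdj (p + 1, s) x})) d →
        HomologyVanishes K G (f '' (_root_.biPendantLadder s t p (p + m + 1))) (d + 1) := by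
      intro d h1 h2
      refine HomologyVanishes.of_pendant (p := p) (s := s) hf ?_ hap (by omega) ?_ h1 h2
      · rintro ⟨i, c⟩ hx
        simp only [_root_.biPendantLadder, Set.mem_ofPred_eq] at hx
        simp only
        omega
      · simp only [_root_.biPendantLadder, Set.mem_ofPred_eq]
        cases s <;> simp <;> omega
    have hdel : ∀ m, _root_.biPendantLadder s t p (p + (m + 1) + 1) \
          {x | x = (p, s) ∨ x = (p + 1, s)} ⊆
        _root_.biPendantLadder (!s) t (p + 1) (p + 1 + m + 1) := by
      rintro m ⟨i, c⟩ hx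
      simp only [_root_.biPendantLadder, Set.mem_ofPred_eq, Set.mem_sdiff, Prod.mk.injEq] at hx ⊢
      cases c <;> cases s <;> cases t <;> simp at hx ⊢ <;> omega
    have hlink : ∀ m, _root_.biPendantLadder s t p (p + (m + 2) + 1) \
          {x | x = (p + 1, s) ∨ LadderAdj (p + 1, s) x} ⊆
        _root_.biPendantLadder (!s) t (p + 2) (p + 2 + m + 1) := by
      rintro m ⟨i, c⟩ hx
      simp only [_root_.biPendantLadder, LadderAdj, Set.mem_ofPred_eq, Set.mem_sdiff,
        Prod.mk.injEq] at hx ⊢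
      cases c <;> cases s <;> cases t <;> simp at hx ⊢ <;> omega
    rcases m with _ | _ | m
    · refine ⟨hstep 0 ?_ ?_, fun _ hst => ?_⟩
      · refine (HomologyVanishes.singleton (f (p + 1, t))).mono ?_ (by omega)
        rintro _ ⟨⟨i, c⟩, hx, rfl⟩
        have : (i, c) = (p + 1, t) := by
          simp only [_root_.biPendantLadder, Set.mem_ofPred_eq, Set.mem_sdiff,
            Prod.mk.injEq] at hx ⊢
          cases c <;> cases s <;> cases t <;> simp at hx ⊢ <;> omega
        rw [this]; rfl
      · refine HomologyVanishes.empty.mono ?_ (by omega)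
        rintro _ ⟨⟨i, c⟩, hx, rfl⟩
        simp only [_root_.biPendantLadder, LadderAdj, Set.mem_ofPred_eq, Set.mem_sdiff,
          Prod.mk.injEq] at hx
        exfalso
        cases c <;> cases s <;> cases t <;> simp at hx <;> omega
      · have hne : s ≠ t := by simpa using hst
        have hmem : ∀ x ∈ _root_.biPendantLadder s t p (p + 0 + 1),
            x = (p, s) ∨ x = (p + 1, t) := by
          rintro ⟨i, c⟩ hx
          simp only [_root_.biPendantLadder, Set.mem_ofPred_eq, Prod.mk.injEq] at hx ⊢
          rcases hx with hx | hx | hx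
          · exact Or.inl hx
          · omega
          · exact Or.inr hx
        refine HomologyVanishes.of_isolated (f (p, s)) ?_
          ((HomologyVanishes.singleton (f (p + 1, t))).mono ?_ (by omega))
        · rintro _ ⟨x, hx, rfl⟩
          rcases hmem x hx with rfl | rfl
          · exact G.irrefl
          · rw [hf _ _ hap (by simp only; omega) (by simp only; omega) (by simp only; omega)]
            simp [LadderAdj, hne]
        · rintro _ ⟨⟨x, hx, rfl⟩, hx'⟩
          rcases hmem x hx with rfl | rfl
          · exact absurd rfl hx'
          · rfl
    · refine ⟨hstep 0 ?_ ?_, fun h => absurd h (by decide)⟩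
      · exact (ih 0 (by omega) (!s) t (p + 1) (by omega) (by omega)).1.mono
          (Set.image_mono (hdel 0)) (by omega)
      · refine (HomologyVanishes.singleton (f (p + 2, t))).mono ?_ (by omega)
        rintro _ ⟨⟨i, c⟩, hx, rfl⟩
        have : (i, c) = (p + 2, t) := by
          simp only [_root_.biPendantLadder, LadderAdj, Set.mem_ofPred_eq, Set.mem_sdiff,
            Prod.mk.injEq] at hx ⊢
          cases c <;> cases s <;> cases t <;> simp at hx ⊢ <;> omega
        rw [this]; rfl
    · have hd : (m + 1 + 1) / 2 = m / 2 + 1 := by omega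
      rw [hd]
      have h1 := (ih (m + 1) (by omega) (!s) t (p + 1) (by omega) (by omega)).1
      have h2 := ih m (by omega) (!s) t (p + 2) (by omega) (by omega)
      refine ⟨hstep _ (h1.mono (Set.image_mono (hdel _)) (by omega))
        (h2.1.mono (Set.image_mono (hlink _)) le_rfl), fun hm hst => ?_⟩
      refine hstep _ (h1.mono (Set.image_mono (hdel _)) ?_)
        ((h2.2 ?_ ?_).mono (Set.image_mono (hlink _)) le_rfl)
      · rw [Nat.even_iff] at hm; omega
      · rw [Nat.even_iff] at hm ⊢; omega
      · rw [Nat.odd_add_one] at hst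
        cases s <;> cases t <;> simp at hst ⊢ <;> simpa using hst

lemma HomologyVanishes.ladder (hf : IsLadderEmbedding G f 1 b) {k : ℕ} (hk : 1 ≤ k)
    (hb : b = 2 * k) : HomologyVanishes K G (f '' {x | 1 ≤ x.1 ∧ x.1 ≤ b}) k := by
  obtain ⟨k, rfl⟩ : ∃ l, k = l + 1 := ⟨k - 1, by omega⟩
  subst hb
  have h1 := HomologyVanishes.pendantLadder (K := K) hf (2 * k + 1) true 1 le_rfl (by omega)
  have h2 := HomologyVanishes.pendantLadder (K := K) hf (2 * k) true 2 (by omega) (by omega)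
  refine HomologyVanishes.of_deletion_link (f (1, false)) (h1.mono ?_ (by omega))
    (h2.mono ?_ (by omega))
  · rintro _ ⟨⟨⟨i, c⟩, hx, rfl⟩, hne⟩
    refine ⟨(i, c), ?_, rfl⟩
    have : ¬ (i = 1 ∧ c = false) := by
      rintro ⟨rfl, rfl⟩
      exact hne rfl
    simp only [_root_.pendantLadder, Set.mem_ofPred_eq] at hx ⊢
    cases c <;> simp at this ⊢ <;> omega
  · rintro _ ⟨⟨⟨i, c⟩, hx, rfl⟩, hne⟩
    refine ⟨(i, c), ?_, rfl⟩
    have h3 : ¬ (i = 1 ∧ c = false) := by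
      rintro ⟨rfl, rfl⟩
      exact hne (Or.inl rfl)
    have h4 : ¬ LadderAdj (1, false) (i, c) := fun h =>
      hne (Or.inr ((hf _ _ le_rfl (by simp only; omega) hx.1 hx.2).mpr h))
    simp only [_root_.pendantLadder, LadderAdj, Set.mem_ofPred_eq] at hx h4 ⊢
    cases c <;> simp at h3 h4 ⊢ <;> omega

end Ladder

/-- Adjacency in the prism over the `n`-cycle, with vertices `(i, c)` for `i < n`. -/
def PrismAdj (n : ℕ) (p q : ℕ × Bool) : Prop :=
  LadderAdj p q ∨
    (p.2 = q.2 ∧ ((p.1 = 0 ∧ q.1 + 1 = n) ∨ (q.1 = 0 ∧ p.1 + 1 = n)))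

section Prism

variable {K : Type*} [Field K] {N : ℕ} {G : SimpleGraph (Fin N)} {f : ℕ × Bool → Fin N} {n k : ℕ}

/-- `f` identifies the prism over the `n`-cycle with `G`. -/
def IsPrism {N : ℕ} (G : SimpleGraph (Fin N)) (f : ℕ × Bool → Fin N) (n : ℕ) : Prop :=
  (∀ x, ∃ p : ℕ × Bool, p.1 < n ∧ f p = x) ∧
    ∀ p q : ℕ × Bool, p.1 < n → q.1 < n → (G.Adj (f p) (f q) ↔ PrismAdj n p q)

lemma IsPrism.isLadderEmbedding (hf : IsPrism G f n) (hn : 1 ≤ n) :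
    IsLadderEmbedding G f 1 (n - 1) := by
  intro p q hp hp' hq hq'
  rw [hf.2 p q (by omega) (by omega), PrismAdj, or_iff_left]
  omega

/-- The subgraph left after removing the closed neighbourhood of `(0, s)` from the prism,
except possibly for the vertex `(0, !s)`. -/
lemma IsPrism.compl_neighbor_subset (hf : IsPrism G f n) (hn : 3 ≤ n) (s : Bool) :
    Set.univ \ {y | y = f (0, s) ∨ G.Adj (f (0, s)) y} ⊆
      f '' biPendantLadder (!s) (!s) 1 (n - 1) := by
  rintro y ⟨-, hy⟩
  obtain ⟨⟨i, c⟩, hi, rfl⟩ := hf.1 y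
  refine ⟨(i, c), ?_, rfl⟩
  have h3 : ¬ (i = 0 ∧ c = s) := by
    rintro ⟨rfl, rfl⟩
    exact hy (Or.inl rfl)
  have h4 : ¬ PrismAdj n (0, s) (i, c) := fun h =>
    hy (Or.inr ((hf.2 _ _ (by simp only; omega) hi).mpr h))
  simp only [biPendantLadder, PrismAdj, LadderAdj, Set.mem_ofPred_eq] at hi h4 ⊢
  cases c <;> cases s <;> simp at h3 h4 ⊢ <;> omega

lemma IsPrism.homologyVanishes (hf : IsPrism G f n) (hk : 1 ≤ k) (hn : n = 2 * k + 1) {d : ℕ}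
    (hd : k ≤ d + 1)
    (hlink : ∀ s, HomologyVanishes K G (f '' biPendantLadder s s 1 (n - 1)) d) :
    HomologyVanishes K G Set.univ (d + 1) := by
  have hlad := HomologyVanishes.ladder (K := K) (hf.isLadderEmbedding (by omega)) hk
    (by omega : n - 1 = 2 * k)
  refine HomologyVanishes.of_deletion_link (f (0, false)) ?_
    ((hlink _).mono (hf.compl_neighbor_subset (by omega) false) le_rfl)
  refine HomologyVanishes.of_deletion_link (f (0, true)) (hlad.mono ?_ hd)
    ((hlink _).mono ((Set.sdiff_subset_sdiff_left (Set.subset_univ _)).trans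
      (hf.compl_neighbor_subset (by omega) true)) le_rfl)
  rintro y ⟨⟨-, hy⟩, hy'⟩
  obtain ⟨⟨i, c⟩, hi, rfl⟩ := hf.1 y
  refine ⟨(i, c), ⟨?_, ?_⟩, rfl⟩
  · rcases i with _ | i
    · cases c
      · exact absurd rfl hy
      · exact absurd rfl hy'
    · simp
  · simp only at hi ⊢
    omega

lemma IsPrism.homologyVanishes_of_even (hf : IsPrism G f n) (hk : 2 ≤ k) (hn : n = 2 * k + 1)
    (hke : Even k) : HomologyVanishes K G Set.univ k := by
  obtain ⟨k, rfl⟩ : ∃ l, k = l + 1 := ⟨k - 1, by omega⟩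
  refine hf.homologyVanishes (by omega) hn le_rfl fun s => ?_
  have h := (HomologyVanishes.biPendantLadder (K := K) (hf.isLadderEmbedding (by omega)) (2 * k)
    s s 1 le_rfl (by omega)).2 (by simp) (by
      rw [Nat.even_add_one, Nat.not_even_iff_odd] at hke
      simpa using hke)
  have he : 1 + 2 * k + 1 = n - 1 := by omega
  rw [he] at h
  exact h.mono le_rfl (by omega)

lemma IsPrism.homologyVanishes_succ (hf : IsPrism G f n) (hk : 1 ≤ k) (hn : n = 2 * k + 1) :
    HomologyVanishes K G Set.univ (k + 1) := by
  refine hf.homologyVanishes hk hn (by omega) fun s => ?_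
  refine (HomologyVanishes.ladder (K := K) (hf.isLadderEmbedding (by omega)) hk
    (by omega : n - 1 = 2 * k)).mono (Set.image_mono ?_) le_rfl
  rintro ⟨i, c⟩ hx
  simp only [biPendantLadder, Set.mem_ofPred_eq] at hx ⊢
  omega

end Prism

/-- The vertex of `C_{2n}(2, n)` corresponding to the vertex `(i, c)` of the prism. -/
def prismVertex (n : ℕ) (p : ℕ × Bool) : ZMod (2 * n) :=
  ((2 * p.1 + if p.2 then n else 0 : ℕ) : ZMod (2 * n))

lemma prismVertex_surjective {n k : ℕ} (hk : n = 2 * k + 1) (x : ZMod (2 * n)) :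
    ∃ p : ℕ × Bool, p.1 < n ∧ prismVertex n p = x := by
  have : NeZero (2 * n) := ⟨by omega⟩
  have hx := x.val_lt
  have key : ∀ p : ℕ × Bool, (2 * p.1 + if p.2 then n else 0) ≡ x.val [MOD 2 * n] →
      prismVertex n p = x := fun p hp => by
    rw [prismVertex, (ZMod.natCast_eq_natCast_iff _ _ _).mpr hp, ZMod.natCast_zmod_val]
  rcases Nat.even_or_odd' x.val with ⟨c, hc | hc⟩
  · exact ⟨(c, false), by simp only; omega, key _ (by simp [hc, Nat.ModEq])⟩
  · by_cases h : n ≤ x.val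
    · refine ⟨(c - k, true), by simp only; omega, key _ ?_⟩
      have : 2 * (c - k) + n = x.val := by omega
      simp [this, Nat.ModEq]
    · refine ⟨(c + k + 1, true), by simp only; omega, key _ ?_⟩
      have : 2 * (c + k + 1) + n = x.val + 2 * n := by omega
      simp [this, Nat.ModEq]

lemma prismVertex_sub_eq_iff {n : ℕ} (p q : ℕ × Bool) (s : ℕ) :
    prismVertex n q - prismVertex n p = (s : ZMod (2 * n)) ↔
      (2 * n : ℤ) ∣ 2 * (q.1 - p.1) + (if q.2 then n else 0) - (if p.2 then n else 0) - s := by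
  have h := ZMod.intCast_zmod_eq_zero_iff_dvd
    (2 * (q.1 - p.1) + (if q.2 then n else 0) - (if p.2 then n else 0) - s : ℤ) (2 * n)
  rw [← sub_eq_zero]
  push_cast at h ⊢
  rw [← h]
  refine Eq.congr ?_ rfl
  unfold prismVertex
  push_cast
  ring

lemma circulant_adj_prismVertex {n k : ℕ} (hk : n = 2 * k + 1) (hn : 4 ≤ n) (p q : ℕ × Bool)
    (hp : p.1 < n) (hq : q.1 < n) :
    (circulant (2 * n) {2, n}).Adj (prismVertex n p) (prismVertex n q) ↔ PrismAdj n p q := by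
  have hdvd : ∀ z : ℤ, -4 * n < z → z < 4 * n →
      ((2 * n : ℤ) ∣ z ↔ z = 0 ∨ z = 2 * n ∨ z = - (2 * n)) := by
    intro z h1 h2
    constructor
    · rintro ⟨c, rfl⟩
      have hc1 : -2 < c := by nlinarith
      have hc2 : c < 2 := by nlinarith
      interval_cases c <;> omega
    · rintro (rfl | rfl | rfl) <;> simp
  have hne : prismVertex n p ≠ prismVertex n q ↔ ¬ (2 * n : ℤ) ∣
      2 * (q.1 - p.1) + (if q.2 then n else 0) - (if p.2 then n else 0) - (0 : ℕ) := by
    rw [← prismVertex_sub_eq_iff, Nat.cast_zero, sub_eq_zero, ne_comm]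
  rw [circulant, SimpleGraph.fromRel_adj, hne]
  simp only [Set.mem_insert_iff, Set.mem_singleton_iff, exists_eq_or_imp, exists_eq_left,
    prismVertex_sub_eq_iff]
  obtain ⟨i, c⟩ := p
  obtain ⟨j, d⟩ := q
  simp only at hp hq
  cases c <;> cases d <;> simp only [PrismAdj, LadderAdj, if_true, if_false, Bool.false_eq_true,
      ne_eq, reduceCtorEq, not_true_eq_false, not_false_eq_true, false_and, true_and, or_false,
      false_or] <;>
    · rw [hdvd _ (by omega) (by omega), hdvd _ (by omega) (by omega), hdvd _ (by omega) (by omega),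
        hdvd _ (by omega) (by omega), hdvd _ (by omega) (by omega)]
      omega

lemma isPrism_circulant {n k : ℕ} [NeZero n] (hn : 4 ≤ n) (hk : n = 2 * k + 1) :
    IsPrism ((circulant (2 * n) {2, n}).comap (Fintype.equivFin (ZMod (2 * n))).symm)
      (fun p => Fintype.equivFin (ZMod (2 * n)) (prismVertex n p)) n := by
  refine ⟨fun x => ?_, fun p q hp hq => ?_⟩
  · obtain ⟨p, hp, hx⟩ := prismVertex_surjective hk ((Fintype.equivFin (ZMod (2 * n))).symm x)
    exact ⟨p, hp, by simp only [hx, Equiv.apply_symm_apply]⟩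
  · rw [SimpleGraph.comap_adj, Equiv.symm_apply_apply, Equiv.symm_apply_apply,
      circulant_adj_prismVertex hk hn p q hp hq]

/-- **Lemma 4.4(ii).**
Let `n ≥ 4` be odd, `n = 2k + 1`, and let `G = C_{2n}(2, n)` be the cubic
circulant graph on `2n` vertices with connection set `{2, n}`.  Then
`reg(I(G)) ≤ k + 1` if `k` is even, and `reg(I(G)) ≤ k + 2` if `k` is odd. -/
theorem regularity_bound_C2n_2_n
    (K : Type*) [Field K] (n : ℕ) [NeZero n] (hn : 4 ≤ n)
    (k : ℕ) (hk : n = 2 * k + 1) :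
    (Even k → regEdgeIdeal K (circulant (2 * n) {2, n}) ≤ k + 1) ∧
    (Odd k → regEdgeIdeal K (circulant (2 * n) {2, n}) ≤ k + 2) := by
  have hf := isPrism_circulant hn hk
  exact ⟨fun he => regEdgeIdeal_le _ _ (hf.homologyVanishes_of_even (by omega) hk he),
    fun _ => regEdgeIdeal_le _ _ (hf.homologyVanishes_succ (by omega) hk)⟩
end

section
/- Let 1 ≤ a < n, set t = gcd(2n, a), and suppose 2n/t is even. Then the edge ideal of the cubic circulant graph C_{2n}(a, n) satisfies: reg(I(C_{2n}(a, n))) = kt + 1 if n/t = 2k, or if n/t = 2k + 1 with k odd; and reg(I(C_{2n}(a, n))) = (k + 1)t + 1 if n/t = 2k + 1 with k even. -/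
namespace Fermion

variable {K : Type*} [Field K] {m : ℕ}

/-- The sign `(-1) ^ #{w ∈ F | w < x}`. -/
def sgn (K : Type*) [Field K] {m : ℕ} (x : Fin m) (F : Finset (Fin m)) : K :=
  (-1) ^ (F.filter (fun w => w < x)).card

theorem sgn_mul_self (x : Fin m) (F : Finset (Fin m)) : sgn K x F * sgn K x F = 1 := by
  rw [sgn, ← mul_pow]
  simp

theorem sgn_insert_self (x : Fin m) (F : Finset (Fin m)) :
    sgn K x (insert x F) = sgn K x F := by
  simp [sgn, Finset.filter_insert]

theorem sgn_insert {x v : Fin m} {F : Finset (Fin m)} (hx : x ∉ F) :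
    sgn K v (insert x F) = (if x < v then -1 else 1) * sgn K v F := by
  rw [sgn, sgn, Finset.filter_insert]
  split_ifs with h
  · rw [Finset.card_insert_of_notMem (by simp [hx]), pow_succ]
    ring
  · simp

theorem sgn_swap {x v : Fin m} {F : Finset (Fin m)} (hxv : x ≠ v) (hx : x ∉ F) (hv : v ∉ F) :
    sgn K x F * sgn K v (insert x F) = -(sgn K v F * sgn K x (insert v F)) := by
  rw [sgn_insert hx, sgn_insert hv]
  rcases lt_or_gt_of_ne hxv with h | h
  · rw [if_pos h, if_neg h.not_gt]
    ring
  · rw [if_pos h, if_neg h.not_gt]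
    ring

/-- Exterior multiplication by the vertex `x` on chains of the full simplex. -/
def create (x : Fin m) (c : Finset (Fin m) → K) : Finset (Fin m) → K :=
  fun F => if x ∈ F then sgn K x F * c (F.erase x) else 0

/-- Contraction with the vertex `x` on chains of the full simplex. -/
def annihilate (x : Fin m) (c : Finset (Fin m) → K) : Finset (Fin m) → K :=
  fun F => if x ∈ F then 0 else sgn K x F * c (insert x F)

/-- The boundary operator on chains of the full simplex. -/
def bd (c : Finset (Fin m) → K) : Finset (Fin m) → K :=
  fun F => ∑ v, annihilate v c F

theorem bd_add (c e : Finset (Fin m) → K) : bd (c + e) = bd c + bd e := by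
  funext F
  simp only [bd, annihilate, Pi.add_apply, ← Finset.sum_add_distrib]
  refine Finset.sum_congr rfl fun v _ => ?_
  split_ifs <;> ring

theorem bd_sub (c e : Finset (Fin m) → K) : bd (c - e) = bd c - bd e := by
  funext F
  simp only [bd, annihilate, Pi.sub_apply, ← Finset.sum_sub_distrib]
  refine Finset.sum_congr rfl fun v _ => ?_
  split_ifs <;> ring

theorem bd_neg (c : Finset (Fin m) → K) : bd (-c) = -bd c := by
  funext F
  simp only [bd, annihilate, Pi.neg_apply, ← Finset.sum_neg_distrib]
  refine Finset.sum_congr rfl fun v _ => ?_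
  split_ifs <;> ring

theorem bd_zero : bd (0 : Finset (Fin m) → K) = 0 := by
  funext F
  simp [bd, annihilate]

theorem create_zero (x : Fin m) : create x (0 : Finset (Fin m) → K) = 0 := by
  funext F
  simp [create]

theorem annihilate_zero (x : Fin m) : annihilate x (0 : Finset (Fin m) → K) = 0 := by
  funext F
  simp [annihilate]

theorem bd_create (x : Fin m) (c : Finset (Fin m) → K) :
    bd (create x c) = c - create x (bd c) := by
  funext F
  simp only [bd, Pi.sub_apply]
  by_cases hx : x ∈ F
  · obtain ⟨E, hE, rfl⟩ : ∃ E, x ∉ E ∧ insert x E = F :=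
      ⟨F.erase x, Finset.notMem_erase x F, Finset.insert_erase hx⟩
    have key : ∀ v, annihilate v (create x c) (insert x E) =
        (if v = x then c (insert x E) else 0) - sgn K x E * annihilate v c E := by
      intro v
      by_cases hvx : v = x
      · subst hvx
        simp [annihilate, hE, ← mul_assoc, sgn_mul_self]
      · by_cases hvE : v ∈ E
        · simp [annihilate, hvE, hvx]
        · have h1 : (insert v (insert x E)).erase x = insert v E := by
            rw [Finset.insert_comm, Finset.erase_insert (by simp [hE, Ne.symm hvx])]
          have h2 : sgn K v (insert x E) * sgn K x (insert v (insert x E)) =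
              -(sgn K x E * sgn K v E) := by
            rw [Finset.insert_comm, sgn_insert_self, sgn_insert hE, sgn_insert hvE]
            rcases lt_or_gt_of_ne hvx with h | h
            · rw [if_pos h, if_neg h.not_gt]
              ring
            · rw [if_pos h, if_neg h.not_gt]
              ring
          simp only [annihilate, create, Finset.mem_insert, hvx, hvE, or_self, if_false,
            true_or, or_true, if_true, h1, ← mul_assoc, h2]
          ring
    simp only [key, Finset.sum_sub_distrib, Finset.sum_ite_eq', Finset.mem_univ, if_true,
      ← Finset.mul_sum, create, Finset.mem_insert_self, sgn_insert_self,
      Finset.erase_insert hE]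
    rfl
  · rw [Finset.sum_eq_single x]
    · simp [annihilate, create, hx, sgn_insert_self, ← mul_assoc, sgn_mul_self]
    · intro v _ hv
      simp [annihilate, create, hx, Ne.symm hv]
    · simp

theorem annihilate_bd (x : Fin m) (c : Finset (Fin m) → K) :
    annihilate x (bd c) = -bd (annihilate x c) := by
  funext F
  by_cases hx : x ∈ F
  · simp [annihilate, bd, hx]
  · simp only [annihilate, bd, hx, if_false, Pi.neg_apply, Finset.mul_sum,
      ← Finset.sum_neg_distrib]
    refine Finset.sum_congr rfl fun v _ => ?_
    by_cases hvx : v = x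
    · subst hvx
      simp
    · by_cases hv : v ∈ F
      · simp [hv]
      · simp only [Finset.mem_insert, hvx, hv, Ne.symm hvx, hx, or_self, if_false]
        rw [← mul_assoc, sgn_swap (Ne.symm hvx) hx hv, Finset.insert_comm]
        ring

theorem annihilate_create {x : Fin m} {c : Finset (Fin m) → K}
    (hc : ∀ F, x ∈ F → c F = 0) : annihilate x (create x c) = c := by
  funext F
  by_cases hx : x ∈ F
  · simp [annihilate, hx, hc F hx]
  · simp [annihilate, create, hx, sgn_insert_self, ← mul_assoc, sgn_mul_self]

theorem annihilate_eq_zero {x : Fin m} {c : Finset (Fin m) → K}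
    (hc : ∀ F, x ∈ F → c F = 0) : annihilate x c = 0 := by
  funext F
  simp [annihilate, hc]

theorem sub_create_annihilate {x : Fin m} (c : Finset (Fin m) → K) {F : Finset (Fin m)}
    (hx : x ∈ F) : (c - create x (annihilate x c)) F = 0 := by
  have h : sgn K x (F.erase x) = sgn K x F := by
    conv_rhs => rw [← Finset.insert_erase hx, sgn_insert_self]
  simp [create, annihilate, hx, h, ← mul_assoc, sgn_mul_self]

end Fermion

namespace SimpleGraph

section Certificates

variable {V : Type*} (G : SimpleGraph V)

/-- The vertices of `S` outside the closed neighbourhood of `x`. -/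
def away (S : Set V) (x : V) : Set V := {y | y ∈ S ∧ y ≠ x ∧ ¬ G.Adj x y}

/-- A recursive certificate, by vertex deletion, for the fact that independence complexes of
induced subgraphs on subsets of `S` have no reduced homology in degrees `≥ d`. -/
inductive Leray : Set V → ℕ → Prop
  | edgeless (S : Set V) (d : ℕ) (h : ∀ u ∈ S, ∀ v ∈ S, ¬ G.Adj u v) : Leray S d
  | delete (S : Set V) (d : ℕ) (x : V) (h₁ : Leray (S \ {x}) (d + 1))
      (h₂ : Leray (G.away S x) d) : Leray S (d + 1)

/-- A recursive certificate, by vertex deletion, for the acyclicity of the independence complex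
of the subgraph induced on `S`. -/
inductive Acyclic : Set V → Prop
  | cone (S : Set V) (u : V) (hu : u ∈ S) (h : ∀ v ∈ S, ¬ G.Adj u v) : Acyclic S
  | delete (S : Set V) (x : V) (h₁ : Acyclic (S \ {x})) (h₂ : Acyclic (G.away S x)) : Acyclic S

/-- A recursive certificate, by vertex deletion, for the fact that the independence complex
of the subgraph induced on `S` has nonzero reduced homology in degree `d - 1`. -/
inductive Spherical : Set V → ℕ → Prop
  | empty : Spherical ∅ 0
  | delete (S : Set V) (d : ℕ) (x : V) (hx : x ∈ S) (h₁ : Acyclic G (S \ {x}))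
      (h₂ : Spherical (G.away S x) d) : Spherical S (d + 1)

variable {G}

theorem Leray.of_edges_subset {S : Set V} {d : ℕ} (h : G.Leray S d) :
    ∀ {T : Set V} {e : ℕ}, d ≤ e → (∀ u ∈ T, ∀ v ∈ T, G.Adj u v → u ∈ S) → G.Leray T e := by
  induction h with
  | edgeless S d h =>
    intro T e _ hT
    exact .edgeless T e fun u hu v hv huv =>
      h u (hT u hu v hv huv) v (hT v hv u hu huv.symm) huv
  | delete S d x h₁ h₂ ih₁ ih₂ =>
    intro T e hde hT
    obtain ⟨e, rfl⟩ : ∃ e', e = e' + 1 := ⟨e - 1, by omega⟩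
    refine .delete T e x (ih₁ hde fun u hu v hv huv => ⟨hT u hu.1 v hv.1 huv, hu.2⟩)
      (ih₂ (by omega) fun u hu v hv huv => ⟨hT u hu.1 v hv.1 huv, hu.2⟩)

theorem Leray.mono {S T : Set V} {d e : ℕ} (h : G.Leray S d) (hTS : T ⊆ S) (hde : d ≤ e) :
    G.Leray T e :=
  h.of_edges_subset hde fun _ hu _ _ _ => hTS hu

theorem Leray.union {S T : Set V} {d e : ℕ} (hS : G.Leray S d) (hT : G.Leray T e)
    (hST : ∀ u ∈ S, ∀ v ∈ T, ¬ G.Adj u v) : G.Leray (S ∪ T) (d + e) := by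
  induction hS with
  | edgeless S d h =>
    refine hT.of_edges_subset (by omega) fun u hu v hv huv => ?_
    rcases hu with hu | hu
    · rcases hv with hv | hv
      · exact absurd huv (h u hu v hv)
      · exact absurd huv (hST u hu v hv)
    · exact hu
  | delete S d x h₁ h₂ ih₁ ih₂ =>
    have h₁' := ih₁ fun u hu => hST u hu.1
    have h₂' := ih₂ fun u hu => hST u hu.1
    rw [add_right_comm]
    by_cases hx : x ∈ S
    · refine .delete _ _ x (add_right_comm d 1 e ▸ h₁'.of_edges_subset le_rfl ?_)
        (h₂'.of_edges_subset le_rfl ?_)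
      · rintro u ⟨hu | hu, hux⟩ v - -
        · exact .inl ⟨hu, hux⟩
        · exact .inr hu
      · rintro u ⟨hu | hu, hux⟩ v - -
        · exact .inl ⟨hu, hux⟩
        · exact .inr hu
    · rw [Set.sdiff_singleton_eq_self hx, add_right_comm] at h₁'
      exact h₁'

theorem Acyclic.union {S T : Set V} (hS : G.Acyclic S)
    (hST : ∀ u ∈ S, ∀ v ∈ T, ¬ G.Adj u v) : G.Acyclic (S ∪ T) := by
  induction hS with
  | cone S u hu h =>
    refine .cone _ u (.inl hu) fun v hv => ?_
    rcases hv with hv | hv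
    · exact h v hv
    · exact hST u hu v hv
  | delete S x h₁ h₂ ih₁ ih₂ =>
    have h₁' := ih₁ fun u hu => hST u hu.1
    have h₂' := ih₂ fun u hu => hST u hu.1
    by_cases hx : x ∈ S
    · by_cases hxT : x ∈ T
      · refine .cone _ x (.inl hx) fun v hv => ?_
        rcases hv with hv | hv
        · exact fun h => hST v hv x hxT h.symm
        · exact hST x hx v hv
      · refine .delete _ x ?_ ?_
        · rwa [Set.union_sdiff_distrib, Set.sdiff_singleton_eq_self hxT]
        · convert h₂' using 1
          ext u
          simp only [away, Set.mem_union, Set.mem_ofPred_eq]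
          constructor
          · rintro ⟨hu | hu, h⟩
            · exact .inl ⟨hu, h⟩
            · exact .inr hu
          · rintro (hu | hu)
            · exact ⟨.inl hu.1, hu.2⟩
            · exact ⟨.inr hu, fun h => hxT (h ▸ hu), hST x hx u hu⟩
    · rwa [Set.sdiff_singleton_eq_self hx] at h₁'

theorem Spherical.union {S T : Set V} {d e : ℕ} (hS : G.Spherical S d) (hT : G.Spherical T e)
    (hST : ∀ u ∈ S, ∀ v ∈ T, ¬ G.Adj u v) (hdisj : Disjoint S T) :
    G.Spherical (S ∪ T) (d + e) := by
  induction hS with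
  | empty => simpa using hT
  | delete S d x hx h₁ h₂ ih =>
    have hxT : x ∉ T := Set.disjoint_left.1 hdisj hx
    rw [add_right_comm]
    refine .delete _ _ x (.inl hx) ?_ ?_
    · rw [Set.union_sdiff_distrib, Set.sdiff_singleton_eq_self hxT]
      exact h₁.union fun u hu => hST u hu.1
    · convert ih (fun u hu => hST u hu.1) (hdisj.mono_left fun u hu => hu.1) using 1
      ext u
      simp only [away, Set.mem_union, Set.mem_ofPred_eq]
      constructor
      · rintro ⟨hu | hu, h⟩
        · exact .inl ⟨hu, h⟩
        · exact .inr hu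
      · rintro (hu | hu)
        · exact ⟨.inl hu.1, hu.2⟩
        · exact ⟨.inr hu, fun h => hxT (h ▸ hu), hST x hx u hu⟩

/-- If `u` is a leaf of the subgraph induced on `S`, attached to `v`, then deleting the closed
neighbourhood of `v` suspends the independence complex. -/
theorem Spherical.leaf {S : Set V} {d : ℕ} (u v : V) (hu : u ∈ S) (hv : v ∈ S) (huv : u ≠ v)
    (hleaf : ∀ w ∈ S, G.Adj u w → w = v) (h : G.Spherical (G.away S v) d) :
    G.Spherical S (d + 1) :=
  .delete S d v hv (.cone _ u ⟨hu, huv⟩ fun w hw huw => hw.2 (hleaf w hw.1 huw)) h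

/-- If `u` is a leaf of the subgraph induced on `S`, attached to `v`, then acyclicity can be
checked after deleting the closed neighbourhood of `v`. -/
theorem Acyclic.leaf {S : Set V} (u v : V) (hu : u ∈ S) (huv : u ≠ v)
    (hleaf : ∀ w ∈ S, G.Adj u w → w = v) (h : G.Acyclic (G.away S v)) :
    G.Acyclic S :=
  .delete S v (.cone _ u ⟨hu, huv⟩ fun w hw huw => hw.2 (hleaf w hw.1 huw)) h

variable {W : Type*} {G' : SimpleGraph W}

/-- `φ` restricts to an isomorphism from the subgraph induced on `S` onto the one induced on its
image. -/
def InducesOn (G : SimpleGraph V) (G' : SimpleGraph W) (φ : V → W) (S : Set V) : Prop :=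
  Set.InjOn φ S ∧ ∀ u ∈ S, ∀ v ∈ S, G'.Adj (φ u) (φ v) ↔ G.Adj u v

theorem InducesOn.mono {φ : V → W} {S T : Set V} (h : InducesOn G G' φ S) (hT : T ⊆ S) :
    InducesOn G G' φ T :=
  ⟨h.1.mono hT, fun u hu v hv => h.2 u (hT hu) v (hT hv)⟩

theorem InducesOn.image_diff {φ : V → W} {S : Set V} (h : InducesOn G G' φ S) {x : V}
    (hx : x ∈ S) : φ '' S \ {φ x} = φ '' (S \ {x}) := by
  ext w
  constructor
  · rintro ⟨⟨u, hu, rfl⟩, hw⟩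
    exact ⟨u, ⟨hu, fun e => hw (congrArg φ e)⟩, rfl⟩
  · rintro ⟨u, ⟨hu, hux⟩, rfl⟩
    exact ⟨⟨u, hu, rfl⟩, fun e => hux (h.1 hu hx e)⟩

theorem InducesOn.away_image {φ : V → W} {S : Set V} (h : InducesOn G G' φ S) {x : V}
    (hx : x ∈ S) : G'.away (φ '' S) (φ x) = φ '' (G.away S x) := by
  ext w
  constructor
  · rintro ⟨⟨u, hu, rfl⟩, hw, hadj⟩
    exact ⟨u, ⟨hu, fun e => hw (congrArg φ e), fun e => hadj ((h.2 x hx u hu).2 e)⟩, rfl⟩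
  · rintro ⟨u, ⟨hu, hux, hadj⟩, rfl⟩
    exact ⟨⟨u, hu, rfl⟩, fun e => hux (h.1 hu hx e), fun e => hadj ((h.2 x hx u hu).1 e)⟩

theorem Leray.image {S : Set V} {d : ℕ} (hS : G.Leray S d) {φ : V → W}
    (h : InducesOn G G' φ S) : G'.Leray (φ '' S) d := by
  induction hS with
  | edgeless S d hS =>
    refine .edgeless _ _ ?_
    rintro _ ⟨u, hu, rfl⟩ _ ⟨v, hv, rfl⟩ huv
    exact hS u hu v hv ((h.2 u hu v hv).1 huv)
  | delete S d x h₁ h₂ ih₁ ih₂ =>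
    have h₁' := ih₁ (h.mono fun u hu => hu.1)
    have h₂' := ih₂ (h.mono fun u hu => hu.1)
    by_cases hx : x ∈ S
    · rw [← h.image_diff hx] at h₁'
      rw [← h.away_image hx] at h₂'
      exact .delete _ _ (φ x) h₁' h₂'
    · rwa [Set.sdiff_singleton_eq_self hx] at h₁'

theorem Acyclic.image {S : Set V} (hS : G.Acyclic S) {φ : V → W}
    (h : InducesOn G G' φ S) : G'.Acyclic (φ '' S) := by
  induction hS with
  | cone S u hu hS =>
    refine .cone _ (φ u) ⟨u, hu, rfl⟩ ?_
    rintro _ ⟨v, hv, rfl⟩ huv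
    exact hS v hv ((h.2 u hu v hv).1 huv)
  | delete S x h₁ h₂ ih₁ ih₂ =>
    have h₁' := ih₁ (h.mono fun u hu => hu.1)
    have h₂' := ih₂ (h.mono fun u hu => hu.1)
    by_cases hx : x ∈ S
    · rw [← h.image_diff hx] at h₁'
      rw [← h.away_image hx] at h₂'
      exact .delete _ (φ x) h₁' h₂'
    · rwa [Set.sdiff_singleton_eq_self hx] at h₁'

theorem Spherical.image {S : Set V} {d : ℕ} (hS : G.Spherical S d) {φ : V → W}
    (h : InducesOn G G' φ S) : G'.Spherical (φ '' S) d := by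
  induction hS with
  | empty => simpa using Spherical.empty
  | delete S d x hx h₁ h₂ ih =>
    refine .delete _ _ (φ x) ⟨x, hx, rfl⟩ ?_ ?_
    · rw [h.image_diff hx]
      exact h₁.image (h.mono fun u hu => hu.1)
    · rw [h.away_image hx]
      exact ih (h.mono fun u hu => hu.1)

end Certificates

section Homology

open Fermion

variable (K : Type*) [Field K] {m : ℕ} (G : SimpleGraph (Fin m))

/-- The chain `c` is supported on independent sets of cardinality `j` contained in `S`. -/
def SupportedOn {K : Type*} [Field K] {m : ℕ} (G : SimpleGraph (Fin m)) (S : Set (Fin m)) (j : ℕ)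
    (c : Finset (Fin m) → K) : Prop :=
  ∀ F, c F ≠ 0 → ((F : Set (Fin m)) ⊆ S ∧ ∀ u ∈ F, ∀ v ∈ F, ¬ G.Adj u v) ∧ F.card = j

/-- The reduced homology of the independence complex of the subgraph induced on `S` vanishes in
degree `j - 1`. -/
def Vanishes (S : Set (Fin m)) (j : ℕ) : Prop :=
  ∀ c : Finset (Fin m) → K, G.SupportedOn S j c → bd c = 0 →
    ∃ e : Finset (Fin m) → K, G.SupportedOn S (j + 1) e ∧ bd e = c

variable {K G}

theorem SupportedOn.mono {S T : Set (Fin m)} {j : ℕ} {c : Finset (Fin m) → K}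
    (hc : G.SupportedOn S j c) (h : S ⊆ T) : G.SupportedOn T j c :=
  fun F hF => ⟨⟨(hc F hF).1.1.trans h, (hc F hF).1.2⟩, (hc F hF).2⟩

theorem SupportedOn.add {S : Set (Fin m)} {j : ℕ} {c e : Finset (Fin m) → K}
    (hc : G.SupportedOn S j c) (he : G.SupportedOn S j e) : G.SupportedOn S j (c + e) := by
  intro F hF
  by_cases h : c F = 0
  · exact he F fun h' => hF (by simp [h, h'])
  · exact hc F h

theorem SupportedOn.neg {S : Set (Fin m)} {j : ℕ} {c : Finset (Fin m) → K}
    (hc : G.SupportedOn S j c) : G.SupportedOn S j (-c) :=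
  fun F hF => hc F fun h => hF (by simp [h])

theorem SupportedOn.sub {S : Set (Fin m)} {j : ℕ} {c e : Finset (Fin m) → K}
    (hc : G.SupportedOn S j c) (he : G.SupportedOn S j e) : G.SupportedOn S j (c - e) :=
  sub_eq_add_neg c e ▸ hc.add he.neg

theorem SupportedOn.zero {S : Set (Fin m)} {j : ℕ} :
    G.SupportedOn S j (0 : Finset (Fin m) → K) :=
  fun _ hF => absurd rfl hF

theorem SupportedOn.eq_zero_of_mem {S : Set (Fin m)} {j : ℕ} {c : Finset (Fin m) → K}
    (hc : G.SupportedOn S j c) {x : Fin m} (hx : x ∉ S) (F : Finset (Fin m)) (hF : x ∈ F) :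
    c F = 0 := by
  by_contra h
  exact hx ((hc F h).1.1 hF)

theorem SupportedOn.diff {S : Set (Fin m)} {j : ℕ} {c : Finset (Fin m) → K}
    (hc : G.SupportedOn S j c) {x : Fin m} (hx : ∀ F, x ∈ F → c F = 0) :
    G.SupportedOn (S \ {x}) j c := by
  refine fun F hF => ⟨⟨fun u hu => ⟨(hc F hF).1.1 hu, ?_⟩, (hc F hF).1.2⟩, (hc F hF).2⟩
  rintro rfl
  exact hF (hx F hu)

theorem SupportedOn.create {S : Set (Fin m)} {j : ℕ} {c : Finset (Fin m) → K} {x : Fin m}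
    (hx : x ∈ S) (hc : G.SupportedOn (G.away S x) j c) :
    G.SupportedOn S (j + 1) (create x c) := by
  intro F hF
  have hxF : x ∈ F := by
    by_contra h
    exact hF (by simp [Fermion.create, h])
  obtain ⟨E, hE, rfl⟩ : ∃ E, x ∉ E ∧ insert x E = F :=
    ⟨F.erase x, Finset.notMem_erase x F, Finset.insert_erase hxF⟩
  obtain ⟨⟨h1, h2⟩, h3⟩ := hc E fun h => hF (by simp [Fermion.create, Finset.erase_insert hE, h])
  refine ⟨⟨?_, ?_⟩, by rw [Finset.card_insert_of_notMem hE, h3]⟩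
  · intro u hu
    rcases Finset.mem_insert.1 (Finset.mem_coe.1 hu) with rfl | hu
    · exact hx
    · exact (h1 hu).1
  · intro u hu v hv
    rcases Finset.mem_insert.1 hu with rfl | hu' <;> rcases Finset.mem_insert.1 hv with rfl | hv'
    · exact G.loopless.irrefl _
    · exact (h1 hv').2.2
    · exact fun h => (h1 hu').2.2 h.symm
    · exact h2 u hu' v hv'

theorem SupportedOn.annihilate {S : Set (Fin m)} {j : ℕ} {c : Finset (Fin m) → K}
    (hc : G.SupportedOn S (j + 1) c) (x : Fin m) :
    G.SupportedOn (G.away S x) j (annihilate x c) := by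
  intro F hF
  have hxF : x ∉ F := by
    intro h
    exact hF (by simp [Fermion.annihilate, h])
  obtain ⟨⟨h1, h2⟩, h3⟩ := hc (insert x F) fun h => hF (by simp [Fermion.annihilate, h])
  rw [Finset.card_insert_of_notMem hxF] at h3
  refine ⟨⟨fun u hu => ⟨h1 (Finset.mem_coe.2 (Finset.mem_insert_of_mem hu)), ?_, ?_⟩, ?_⟩, by omega⟩
  · rintro rfl
    exact hxF hu
  · exact h2 x (Finset.mem_insert_self _ _) u (Finset.mem_insert_of_mem hu)
  · exact fun u hu v hv => h2 u (Finset.mem_insert_of_mem hu) v (Finset.mem_insert_of_mem hv)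

theorem away_subset_diff (G : SimpleGraph (Fin m)) (S : Set (Fin m)) (x : Fin m) :
    G.away S x ⊆ S \ {x} :=
  fun _ hu => ⟨hu.1, hu.2.1⟩

theorem notMem_away (G : SimpleGraph (Fin m)) (S : Set (Fin m)) (x : Fin m) :
    x ∉ G.away S x :=
  fun h => h.2.1 rfl

theorem away_eq_diff {S : Set (Fin m)} {x : Fin m} (h : ∀ v ∈ S, ¬ G.Adj x v) :
    G.away S x = S \ {x} :=
  Set.ext fun u => ⟨fun hu => ⟨hu.1, hu.2.1⟩, fun hu => ⟨hu.1, hu.2, h u hu.1⟩⟩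

theorem Vanishes.cone {S : Set (Fin m)} {u : Fin m} (hu : u ∈ S) (h : ∀ v ∈ S, ¬ G.Adj u v)
    (j : ℕ) : G.Vanishes K S j := by
  intro c hc hbd
  have hc' : G.SupportedOn (G.away S u) j (c - create u (annihilate u c)) := by
    rw [away_eq_diff h]
    refine SupportedOn.diff (hc.sub ?_) fun F hF => sub_create_annihilate c hF
    rcases j with _ | j
    · have : annihilate u c = 0 := annihilate_eq_zero fun F hF => by
        by_contra h0
        have := (hc F h0).2
        rw [Finset.card_eq_zero] at this
        simp [this] at hF
      rw [this, create_zero]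
      exact .zero
    · exact (hc.annihilate u).create hu
  refine ⟨create u (c - create u (annihilate u c)), hc'.create hu, ?_⟩
  have h1 : bd (annihilate u c) = 0 := by
    rw [← neg_eq_zero, ← annihilate_bd, hbd, annihilate_zero]
  rw [bd_create, bd_sub, hbd, bd_create, h1, create_zero, sub_zero, zero_sub]
  have h2 : create u (-annihilate u c) = -create u (annihilate u c) := by
    funext F
    simp only [create, Pi.neg_apply]
    split_ifs <;> ring
  rw [h2]
  abel

theorem Vanishes.delete_succ {S : Set (Fin m)} {x : Fin m} {j : ℕ} (hx : x ∈ S)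
    (h₁ : G.Vanishes K (S \ {x}) (j + 1)) (h₂ : G.Vanishes K (G.away S x) j) :
    G.Vanishes K S (j + 1) := by
  intro c hc hbd
  have h1 : bd (annihilate x c) = 0 := by
    rw [← neg_eq_zero, ← annihilate_bd, hbd, annihilate_zero]
  obtain ⟨e, he, hbe⟩ := h₂ _ (hc.annihilate x) h1
  have hxe : ∀ F, x ∈ F → e F = 0 := he.eq_zero_of_mem (notMem_away G S x)
  have hce : c + bd (create x e) = (c - create x (annihilate x c)) + e := by
    rw [bd_create, hbe]
    abel
  obtain ⟨f, hf, hbf⟩ := h₁ (c + bd (create x e)) (by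
      rw [hce]
      refine SupportedOn.diff ((hc.sub ((hc.annihilate x).create hx)).add
        (he.mono fun u hu => hu.1)) fun F hF => ?_
      rw [Pi.add_apply, sub_create_annihilate c hF, hxe F hF, add_zero])
    (by rw [bd_create, hbe, bd_add, hbd, bd_sub, bd_create, hbe, h1, create_zero]; abel)
  refine ⟨f - create x e, (hf.mono fun u hu => hu.1).sub (he.create hx), ?_⟩
  rw [bd_sub, hbf]
  abel

theorem Vanishes.zero_mono {S T : Set (Fin m)} (h : G.Vanishes K S 0) (hST : S ⊆ T) :
    G.Vanishes K T 0 := by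
  intro c hc hbd
  obtain ⟨e, he, hbe⟩ := h c (fun F hF => by
    have hcF := hc F hF
    rw [Finset.card_eq_zero] at hcF
    simp [hcF.2]) hbd
  exact ⟨e, he.mono hST, hbe⟩

theorem Leray.vanishes {S : Set (Fin m)} {d : ℕ} (h : G.Leray S d) :
    ∀ {T : Set (Fin m)}, T ⊆ S → ∀ {j : ℕ}, d < j → G.Vanishes K T j := by
  induction h with
  | edgeless S d h =>
    intro T hT j hj
    rcases T.eq_empty_or_nonempty with rfl | ⟨u, hu⟩
    · intro c hc _
      refine ⟨0, .zero, ?_⟩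
      rw [bd_zero]
      funext F
      by_contra h0
      have hF := hc F (Ne.symm h0)
      rw [Set.subset_empty_iff, Finset.coe_eq_empty] at hF
      have := hF.2
      rw [hF.1.1, Finset.card_empty] at this
      omega
    · exact .cone hu (fun v hv => h u (hT hu) v (hT hv)) j
  | delete S d x h₁ h₂ ih₁ ih₂ =>
    intro T hT j hj
    obtain ⟨j, rfl⟩ : ∃ i, j = i + 1 := ⟨j - 1, by omega⟩
    by_cases hx : x ∈ T
    · exact .delete_succ hx (ih₁ (Set.sdiff_subset_sdiff_left hT) hj)
        (ih₂ (fun u hu => ⟨hT hu.1, hu.2⟩) (by omega))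
    · exact ih₁ (fun u hu => ⟨hT hu, fun e => hx (e ▸ hu)⟩) hj

theorem Acyclic.vanishes {S : Set (Fin m)} (h : G.Acyclic S) (j : ℕ) : G.Vanishes K S j := by
  induction h generalizing j with
  | cone S u hu h => exact .cone hu h j
  | delete S x h₁ h₂ ih₁ ih₂ =>
    by_cases hx : x ∈ S
    · rcases j with _ | j
      · exact (ih₁ 0).zero_mono Set.sdiff_subset
      · exact .delete_succ hx (ih₁ _) (ih₂ _)
    · rw [Set.sdiff_singleton_eq_self hx] at ih₁
      exact ih₁ j

theorem Vanishes.away_of_succ {S : Set (Fin m)} {x : Fin m} {d : ℕ} (hx : x ∈ S)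
    (h₁ : G.Vanishes K (S \ {x}) d) (h : G.Vanishes K S (d + 1)) :
    G.Vanishes K (G.away S x) d := by
  intro c hc hbd
  obtain ⟨e, he, hbe⟩ := h₁ c (hc.mono (away_subset_diff G S x)) hbd
  obtain ⟨w, hw, hbw⟩ := h (create x c - e) ((hc.create hx).sub (he.mono Set.sdiff_subset)) (by
    rw [bd_sub, bd_create, hbd, create_zero, hbe]
    abel)
  refine ⟨-annihilate x w, (hw.annihilate x).neg, ?_⟩
  have hxe : ∀ F, x ∈ F → e F = 0 := he.eq_zero_of_mem fun h => h.2 rfl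
  have hsub : annihilate x (create x c - e) = annihilate x (create x c) - annihilate x e := by
    funext F
    simp only [annihilate, Pi.sub_apply]
    split_ifs <;> ring
  rw [bd_neg, ← annihilate_bd, hbw, hsub, annihilate_eq_zero hxe, sub_zero,
    annihilate_create (hc.eq_zero_of_mem (notMem_away G S x))]

theorem Spherical.not_vanishes {S : Set (Fin m)} {d : ℕ} (h : G.Spherical S d) :
    ¬ G.Vanishes K S d := by
  induction h with
  | empty =>
    intro h
    obtain ⟨e, he, hbe⟩ := h (fun F => if F = ∅ then 1 else 0) (by
      intro F hF
      have : F = ∅ := by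
        by_contra h
        exact hF (if_neg h)
      simp [this]) (by
      funext F
      simp [bd, annihilate])
    have he0 : e = 0 := by
      funext F
      by_contra h0
      have hF := he F h0
      rw [Set.subset_empty_iff, Finset.coe_eq_empty] at hF
      have := hF.2
      rw [hF.1.1, Finset.card_empty] at this
      omega
    have := congrFun hbe ∅
    rw [he0, bd_zero] at this
    simp at this
  | delete S d x hx h₁ h₂ ih =>
    exact fun h => ih (.away_of_succ hx (h₁.vanishes d) h)

end Homology

end SimpleGraph

namespace SimpleGraph

section Regularity

open Fermion

variable (K : Type*) [Field K] {m : ℕ} (G : SimpleGraph (Fin m))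

theorem sum_bcoeff_mul (c : Finset (Fin m) → K) (F : Finset (Fin m)) :
    ∑ E, bcoeff K E F * c E = bd c F := by
  simp only [bcoeff, bd, Finset.sum_mul]
  have h : ∀ E : Finset (Fin m),
      (∑ v ∈ E, (if E.erase v = F then (-1 : K) ^ (E.filter (fun w => w < v)).card else 0) * c E) =
        ∑ v, if v ∈ E ∧ E.erase v = F then sgn K v E * c E else 0 := by
    intro E
    rw [← Finset.sum_filter_add_sum_filter_not Finset.univ (fun v => v ∈ E)]
    have h0 : ∑ v ∈ Finset.univ.filter (fun v => v ∉ E),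
        (if v ∈ E ∧ E.erase v = F then sgn K v E * c E else 0) = 0 :=
      Finset.sum_eq_zero fun v hv => by simp [(Finset.mem_filter.1 hv).2]
    rw [h0, add_zero, Finset.filter_mem_eq_inter, Finset.univ_inter]
    refine Finset.sum_congr rfl fun v hv => ?_
    simp only [hv, true_and, sgn, ite_mul, zero_mul]
  simp only [h]
  rw [Finset.sum_comm]
  refine Finset.sum_congr rfl fun v _ => ?_
  by_cases hv : v ∈ F
  · rw [annihilate, if_pos hv]
    refine Finset.sum_eq_zero fun E _ => if_neg ?_
    rintro ⟨-, rfl⟩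
    simp at hv
  · rw [annihilate, if_neg hv, Finset.sum_eq_single (insert v F)]
    · simp [hv, sgn_insert_self]
    · intro E _ hE
      refine if_neg ?_
      rintro ⟨h1, rfl⟩
      exact hE (Finset.insert_erase h1).symm
    · simp

variable {K G}

theorem SupportedOn.bd {S : Set (Fin m)} {j : ℕ} {c : Finset (Fin m) → K}
    (hc : G.SupportedOn S (j + 1) c) : G.SupportedOn S j (bd c) := by
  intro F hF
  obtain ⟨v, -, hv⟩ := Finset.exists_ne_zero_of_sum_ne_zero hF
  obtain ⟨⟨h1, h2⟩, h3⟩ := hc.annihilate v F hv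
  exact ⟨⟨fun u hu => (h1 hu).1, h2⟩, h3⟩

variable {Δ : Finset (Finset (Fin m))}

/-- Extension by zero of a chain of `Δ` to a chain of the full simplex. -/
noncomputable def extendChain {K : Type*} [Field K] {m : ℕ} {Δ : Finset (Finset (Fin m))} {j : ℕ}
    (f : {F // F ∈ cfaces Δ j} → K) : Finset (Fin m) → K :=
  fun F => if h : F ∈ cfaces Δ j then f ⟨F, h⟩ else 0

theorem boundaryMap_apply {j : ℕ} (f : {F // F ∈ cfaces Δ (j + 1)} → K)
    (F : {F // F ∈ cfaces Δ j}) :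
    boundaryMap K Δ j f F = bd (extendChain f) F.1 := by
  rw [← sum_bcoeff_mul]
  simp only [boundaryMap, LinearMap.pi_apply, LinearMap.coe_sum, Finset.sum_apply,
    LinearMap.smul_apply, LinearMap.proj_apply, smul_eq_mul]
  rw [← Finset.sum_subset (Finset.subset_univ (cfaces Δ (j + 1)))]
  · rw [← Finset.sum_coe_sort (cfaces Δ (j + 1))]
    refine Finset.sum_congr rfl fun E _ => ?_
    rw [extendChain, dif_pos E.2]
  · intro E _ hE
    rw [extendChain, dif_neg hE, mul_zero]

theorem bettiNumber_ne_zero_iff (i j : ℕ) :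
    bettiNumber K Δ i j ≠ 0 ↔ ∃ W : Finset (Fin m), W.card = j ∧
      reducedHomologyRank K (Δ.filter (fun F => F ⊆ W)) ((j : ℤ) - i - 2) ≠ 0 := by
  simp [bettiNumber, Finset.sum_eq_zero_iff, Finset.mem_powersetCard]

variable (hΔ : ∀ F, F ∈ Δ ↔ ∀ u ∈ F, ∀ v ∈ F, ¬ G.Adj u v) (W : Finset (Fin m))

include hΔ

theorem mem_cfaces_filter_iff {j : ℕ} {F : Finset (Fin m)} :
    F ∈ cfaces (Δ.filter (fun F => F ⊆ W)) j ↔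
      ((F : Set (Fin m)) ⊆ W ∧ ∀ u ∈ F, ∀ v ∈ F, ¬ G.Adj u v) ∧ F.card = j := by
  simp only [cfaces, Finset.mem_filter, hΔ, Finset.coe_subset]
  tauto

theorem supportedOn_extendChain {j : ℕ}
    (f : {F // F ∈ cfaces (Δ.filter (fun F => F ⊆ W)) j} → K) :
    G.SupportedOn W j (extendChain f) := by
  intro F hF
  rw [← mem_cfaces_filter_iff hΔ]
  by_contra h
  exact hF (dif_neg h)

theorem extendChain_restrict {j : ℕ} {c : Finset (Fin m) → K} (hc : G.SupportedOn W j c) :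
    extendChain (fun F : {F // F ∈ cfaces (Δ.filter (fun F => F ⊆ W)) j} => c F.1) = c := by
  funext F
  rw [extendChain]
  split_ifs with h
  · rfl
  · by_contra h0
    exact h ((mem_cfaces_filter_iff hΔ W).2 (hc F (Ne.symm h0)))

theorem bd_extendChain_eq_iff {j : ℕ}
    (f : {F // F ∈ cfaces (Δ.filter (fun F => F ⊆ W)) (j + 1)} → K)
    {c : Finset (Fin m) → K} (hc : G.SupportedOn W j c) :
    bd (extendChain f) = c ↔ boundaryMap K (Δ.filter (fun F => F ⊆ W)) j f = fun F => c F.1 := by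
  constructor
  · intro h
    funext F
    rw [boundaryMap_apply, h]
  · intro h
    have hbd := (supportedOn_extendChain hΔ W f).bd
    rw [← extendChain_restrict hΔ W hbd, ← extendChain_restrict hΔ W hc]
    congr 1
    rw [← h]
    funext F
    rw [boundaryMap_apply]

theorem reducedHomologyRank_eq_zero_iff (j : ℕ) :
    reducedHomologyRank K (Δ.filter (fun F => F ⊆ W)) ((j : ℤ) - 1) = 0 ↔
      G.Vanishes K W j := by
  rcases j with _ | j
  · rw [reducedHomologyRank, if_pos (by simp), Module.finrank_zero_iff,
      Submodule.Quotient.subsingleton_iff, LinearMap.range_eq_top]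
    constructor
    · intro h c hc _
      obtain ⟨f, hf⟩ := h fun F => c F.1
      exact ⟨extendChain f, supportedOn_extendChain hΔ W f, (bd_extendChain_eq_iff hΔ W f hc).2 hf⟩
    · intro h f
      have hf := supportedOn_extendChain hΔ W f
      obtain ⟨e, he, hbe⟩ := h (extendChain f) hf (by
        funext F
        refine Finset.sum_eq_zero fun v _ => ?_
        rw [annihilate]
        split_ifs with hv
        · rfl
        · have : extendChain f (insert v F) = 0 := by
            by_contra h0
            have := (hf _ h0).2
            simp at this
          rw [this, mul_zero])
      refine ⟨fun F => e F.1, ?_⟩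
      rw [← extendChain_restrict hΔ W he, bd_extendChain_eq_iff hΔ W _ hf] at hbe
      rw [hbe]
      funext F
      rw [extendChain, dif_pos F.2]
  · have hj : (((j + 1 : ℕ) : ℤ) - 1).toNat = j := by simp
    rw [reducedHomologyRank, if_neg (by push_cast; omega), if_pos (by push_cast; omega), hj,
      Module.finrank_zero_iff, Submodule.Quotient.subsingleton_iff, Submodule.eq_top_iff']
    constructor
    · intro h c hc hbd
      have hz : (fun F : {F // F ∈ cfaces (Δ.filter (fun F => F ⊆ W)) (j + 1)} => c F.1) ∈
          LinearMap.ker (boundaryMap K (Δ.filter (fun F => F ⊆ W)) j) := by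
        rw [LinearMap.mem_ker]
        exact (bd_extendChain_eq_iff hΔ W _ .zero).1 (by rw [extendChain_restrict hΔ W hc, hbd])
      obtain ⟨f, hf⟩ := h ⟨_, hz⟩
      exact ⟨extendChain f, supportedOn_extendChain hΔ W f, (bd_extendChain_eq_iff hΔ W f hc).2 hf⟩
    · rintro h ⟨f, hf⟩
      have hs := supportedOn_extendChain hΔ W f
      obtain ⟨e, he, hbe⟩ := h (extendChain f) hs
        ((bd_extendChain_eq_iff hΔ W f .zero).2 (LinearMap.mem_ker.1 hf))
      refine ⟨fun F => e F.1, ?_⟩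
      rw [← extendChain_restrict hΔ W he, bd_extendChain_eq_iff hΔ W _ hs] at hbe
      rw [hbe]
      funext F
      exact dif_pos F.2

theorem regSR_eq_of_certificates {D : ℕ} (hD : 1 ≤ D) (h₁ : G.Leray Set.univ D)
    {S : Set (Fin m)} (h₂ : G.Spherical S D) : regSR K Δ = D + 1 := by
  classical
  refine IsGreatest.csSup_eq ⟨?_, ?_⟩
  · set W := S.toFinset with hW
    have hnv : ¬ G.Vanishes K (W : Set (Fin m)) D := by
      rw [hW, Set.coe_toFinset]
      exact h₂.not_vanishes
    have hcard : D + 1 ≤ W.card := by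
      by_contra hlt
      refine hnv fun c hc _ => ?_
      by_cases hc0 : c = 0
      · exact ⟨0, .zero, by rw [bd_zero, hc0]⟩
      · obtain ⟨F, hF⟩ := Function.ne_iff.1 hc0
        obtain ⟨⟨h3, h4⟩, h5⟩ := hc F hF
        have hFW : F = W := Finset.eq_of_subset_of_card_le (Finset.coe_subset.1 h3) (by omega)
        obtain ⟨u, hu⟩ : F.Nonempty := Finset.card_pos.1 (by omega)
        rw [hFW] at h4 hu
        exact absurd (Vanishes.cone (Finset.mem_coe.2 hu) (fun v hv => h4 u hu v hv) D) hnv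
    refine ⟨W.card - (D + 1), W.card, ?_, by omega⟩
    rw [bettiNumber_ne_zero_iff]
    refine ⟨W, rfl, fun h => hnv ((reducedHomologyRank_eq_zero_iff hΔ W D).1 ?_)⟩
    rw [← h]
    congr 1
    omega
  · rintro d ⟨i, j, hb, hd⟩
    obtain ⟨W, -, hW⟩ := (bettiNumber_ne_zero_iff i j).1 hb
    by_contra hlt
    refine hW ?_
    have := (reducedHomologyRank_eq_zero_iff (K := K) hΔ W (d - 1)).2
      (h₁.vanishes (Set.subset_univ _) (by omega))
    rw [← this]
    congr 1
    omega

end Regularity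

theorem regEdgeIdeal_eq_of_certificates (K : Type*) [Field K] {V : Type*} [Fintype V]
    {G : SimpleGraph V} {D : ℕ} (hD : 1 ≤ D) (h₁ : G.Leray Set.univ D) {S : Set V}
    (h₂ : G.Spherical S D) : regEdgeIdeal K G = D + 1 := by
  have h : ∀ T, InducesOn G (G.comap (Fintype.equivFin V).symm) (Fintype.equivFin V) T :=
    fun T => ⟨(Fintype.equivFin V).injective.injOn, fun u _ v _ => by simp⟩
  have h₁' := h₁.image (h _)
  rw [Set.image_univ, (Fintype.equivFin V).surjective.range_eq] at h₁'
  exact regSR_eq_of_certificates (G := G.comap (Fintype.equivFin V).symm)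
    (fun F => by simp [indComplex]) hD h₁' (h₂.image (h _))

end SimpleGraph

namespace SimpleGraph

/-- The infinite ladder: the vertices `(i, s)`, `(j, s')` are adjacent when the signs `s`, `s'`
are opposite and `|i - j| ≤ 1`. -/
def ladder : SimpleGraph (ℤ × Bool) where
  Adj p q := p.2 ≠ q.2 ∧ p.1 ≤ q.1 + 1 ∧ q.1 ≤ p.1 + 1
  symm := ⟨fun _ _ h => ⟨h.1.symm, h.2.2, h.2.1⟩⟩
  loopless := ⟨fun _ h => h.1 rfl⟩

theorem ladder_adj (p q : ℤ × Bool) :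
    ladder.Adj p q ↔ p.2 ≠ q.2 ∧ p.1 ≤ q.1 + 1 ∧ q.1 ≤ p.1 + 1 := Iff.rfl

/-- The rungs `l, …, r` of the ladder with a pendant vertex of sign `s` at position `l - 1`. -/
def pendantLadder (l r : ℤ) (s : Bool) : Set (ℤ × Bool) :=
  {p | (l ≤ p.1 ∧ p.1 ≤ r) ∨ (p.1 = l - 1 ∧ p.2 = s)}

/-- All vertices of sign `s`, and the vertices of the other sign at positions `l, …, r`. -/
def fence (l r : ℤ) (s : Bool) : Set (ℤ × Bool) :=
  {p | p.2 = s ∨ (l ≤ p.1 ∧ p.1 ≤ r)}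

/-- The vertices of sign `s` at positions `≥ l`, and those of the other sign at positions
`≤ r`. -/
def staircase (l r : ℤ) (s : Bool) : Set (ℤ × Bool) :=
  {p | (p.2 = s ∧ l ≤ p.1) ∨ (p.2 ≠ s ∧ p.1 ≤ r)}

theorem leray_pendantLadder (n : ℕ) :
    ∀ (l r : ℤ) (s : Bool), r - l + 1 ≤ n → ladder.Leray (pendantLadder l r s) ((n + 1) / 2) := by
  induction n using Nat.strong_induction_on with
  | _ n ih =>
    intro l r s h
    rcases n with _ | n
    · refine .edgeless _ _ ?_
      rintro ⟨i, b⟩ hi ⟨j, b'⟩ hj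
      simp only [pendantLadder, Set.mem_ofPred_eq, ladder_adj] at *
      cases s <;> cases b <;> cases b' <;> grind
    · obtain ⟨e, he⟩ : ∃ e, (n + 1 + 1) / 2 = e + 1 := ⟨n / 2, by omega⟩
      rw [he]
      refine .delete _ _ (l, !s) ?_ ?_
      · refine (ih n (by omega) (l + 1) r s (by omega)).of_edges_subset (by omega) ?_
        rintro ⟨i, b⟩ hi ⟨j, b'⟩ hj
        simp only [pendantLadder, Set.mem_ofPred_eq, ladder_adj, Set.mem_sdiff,
          Set.mem_singleton_iff, Prod.mk.injEq] at *
        cases s <;> cases b <;> cases b' <;> grind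
      · refine (ih (n - 1) (by omega) (l + 2) r (!s) (by omega)).of_edges_subset (by omega) ?_
        rintro ⟨i, b⟩ hi ⟨j, b'⟩ hj
        simp only [pendantLadder, Set.mem_ofPred_eq, ladder_adj, away, ne_eq,
          Prod.mk.injEq] at *
        cases s <;> cases b <;> cases b' <;> grind

theorem leray_staircase {l r : ℤ} {s : Bool} {d : ℕ} (h : ladder.Leray (fence (l + 2) r s) d) :
    ladder.Leray (staircase l r s) (d + 1) := by
  obtain ⟨n, hn⟩ : ∃ n : ℕ, r + 1 - l ≤ n := ⟨(r + 1 - l).toNat, by omega⟩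
  induction n generalizing l with
  | zero =>
    by_cases hlr : l = r + 1
    · refine .delete _ _ (l, s) (.edgeless _ _ ?_) (.edgeless _ _ ?_) <;>
      · rintro ⟨i, b⟩ hi ⟨j, b'⟩ hj
        simp only [staircase, Set.mem_ofPred_eq, ladder_adj, Set.mem_sdiff, away, ne_eq,
          Set.mem_singleton_iff, Prod.mk.injEq] at *
        cases s <;> cases b <;> cases b' <;> grind
    · refine .edgeless _ _ ?_
      rintro ⟨i, b⟩ hi ⟨j, b'⟩ hj
      simp only [staircase, Set.mem_ofPred_eq, ladder_adj] at *
      cases s <;> cases b <;> cases b' <;> grind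
  | succ n ih =>
    refine .delete _ _ (l, s) ((@ih (l + 1) (h.mono ?_ le_rfl) (by omega)).mono ?_ le_rfl)
      (h.of_edges_subset le_rfl ?_)
    · rintro ⟨i, b⟩ hi
      simp only [fence, Set.mem_ofPred_eq] at *
      cases s <;> cases b <;> grind
    · rintro ⟨i, b⟩ hi
      simp only [staircase, Set.mem_ofPred_eq, Set.mem_sdiff, Set.mem_singleton_iff,
        Prod.mk.injEq] at *
      cases s <;> cases b <;> grind
    · rintro ⟨i, b⟩ hi ⟨j, b'⟩ hj
      simp only [staircase, fence, Set.mem_ofPred_eq, ladder_adj, away, ne_eq,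
        Prod.mk.injEq] at *
      cases s <;> cases b <;> cases b' <;> grind

theorem leray_fence_step {l r : ℤ} {s : Bool} {d : ℕ}
    (h₁ : ladder.Leray (fence (l + 1) r s) (d + 2)) (h₂ : ladder.Leray (fence (l + 4) r s) d) :
    ladder.Leray (fence l r s) (d + 2) := by
  refine .delete _ _ (l, !s) (h₁.mono ?_ le_rfl)
    ((leray_staircase (l := l + 2) (r := r) (s := s) ?_).of_edges_subset le_rfl ?_)
  · rintro ⟨i, b⟩ hi
    simp only [fence, Set.mem_ofPred_eq, Set.mem_sdiff, Set.mem_singleton_iff,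
      Prod.mk.injEq] at *
    cases s <;> cases b <;> grind
  · rwa [show l + 2 + 2 = l + 4 by ring]
  · rintro ⟨i, b⟩ hi ⟨j, b'⟩ hj
    simp only [staircase, fence, Set.mem_ofPred_eq, ladder_adj, away, ne_eq,
      Prod.mk.injEq] at *
    cases s <;> cases b <;> cases b' <;> grind

theorem fence_anti {l l' r : ℤ} {s : Bool} (h : l ≤ l') : fence l' r s ⊆ fence l r s := by
  rintro ⟨i, b⟩ hi
  simp only [fence, Set.mem_ofPred_eq] at *
  cases s <;> cases b <;> grind

theorem leray_fence (q : ℕ) :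
    ∀ (l r : ℤ) (s : Bool), r - l + 1 ≤ 4 * q → ladder.Leray (fence l r s) (2 * q) := by
  induction q with
  | zero =>
    intro l r s h
    refine .edgeless _ _ ?_
    rintro ⟨i, b⟩ hi ⟨j, b'⟩ hj
    simp only [fence, Set.mem_ofPred_eq, ladder_adj] at *
    cases s <;> cases b <;> cases b' <;> grind
  | succ q ih =>
    intro l r s h
    have h4 := ih (l + 4) r s (by push_cast at h; omega)
    have step : ∀ j : ℕ, j ≤ 4 → ladder.Leray (fence (l + 4 - j) r s) (2 * q + 2) := by
      intro j
      induction j with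
      | zero => exact fun _ => h4.mono (fence_anti (by simp)) (by omega)
      | succ j ihj =>
        intro hj
        refine leray_fence_step ?_ (h4.mono (fence_anti (by push_cast; omega)) le_rfl)
        convert ihj (by omega) using 2
        push_cast
        ring
    convert step 4 le_rfl using 2 <;> push_cast <;> ring

/-- The vertices of sign `s` at positions `l - 1, …, r + 1`, and those of the other sign at
positions `l, …, r`. -/
def finiteFence (l r : ℤ) (s : Bool) : Set (ℤ × Bool) :=
  {p | (p.2 = s ∧ l - 1 ≤ p.1 ∧ p.1 ≤ r + 1) ∨ (p.2 ≠ s ∧ l ≤ p.1 ∧ p.1 ≤ r)}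

theorem away_away_finiteFence (l r : ℤ) (s : Bool) :
    ladder.away (ladder.away (finiteFence l r s) (l, !s)) (l + 2, s) =
      finiteFence (l + 4) r s := by
  ext ⟨i, b⟩
  simp only [finiteFence, Set.mem_ofPred_eq, ladder_adj, away, ne_eq, Prod.mk.injEq]
  cases s <;> cases b <;> grind

theorem spherical_finiteFence (q : ℕ) :
    ∀ (l r : ℤ) (s : Bool), r - l + 3 = 4 * q → ladder.Spherical (finiteFence l r s) (2 * q) := by
  induction q with
  | zero =>
    intro l r s h
    convert Spherical.empty
    ext ⟨i, b⟩
    simp only [finiteFence, Set.mem_ofPred_eq, Set.mem_empty_iff_false, iff_false]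
    cases s <;> cases b <;> grind
  | succ q ih =>
    intro l r s h
    have h' := ih (l + 4) r s (by push_cast at h; omega)
    rw [← away_away_finiteFence] at h'
    refine .leaf (d := 2 * q + 1) (l - 1, s) (l, !s) ?_ ?_ ?_ ?_
      (.leaf (l + 1, !s) (l + 2, s) ?_ ?_ ?_ ?_ h')
    all_goals
      try rintro ⟨i, b⟩ hi
      simp only [finiteFence, Set.mem_ofPred_eq, ladder_adj, away, ne_eq, Prod.mk.injEq] at *
      cases s <;> grind

theorem acyclic_finiteFence (q : ℕ) :
    ∀ (l r : ℤ) (s : Bool), r - l + 2 = 4 * q → ladder.Acyclic (finiteFence l r s) := by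
  induction q with
  | zero =>
    intro l r s h
    refine .cone _ (l - 1, s) ?_ ?_
    all_goals
      try rintro ⟨i, b⟩ hi
      simp only [finiteFence, Set.mem_ofPred_eq, ladder_adj] at *
      cases s <;> grind
  | succ q ih =>
    intro l r s h
    have h' := ih (l + 4) r s (by push_cast at h; omega)
    rw [← away_away_finiteFence] at h'
    refine .leaf (l - 1, s) (l, !s) ?_ ?_ ?_ (.leaf (l + 1, !s) (l + 2, s) ?_ ?_ ?_ h')
    all_goals
      try rintro ⟨i, b⟩ hi
      simp only [finiteFence, Set.mem_ofPred_eq, ladder_adj, away, ne_eq, Prod.mk.injEq] at *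
      cases s <;> grind

/-- The vertices of sign `s` at positions `l, …, r`, and those of the other sign at positions
`l, …, r + 1`. -/
def brokenLadder (l r : ℤ) (s : Bool) : Set (ℤ × Bool) :=
  {p | l ≤ p.1 ∧ (p.1 ≤ r ∨ (p.2 ≠ s ∧ p.1 = r + 1))}

theorem acyclic_brokenLadder (q : ℕ) :
    ∀ (l r : ℤ) (s : Bool), r - l = 4 * q + 1 → ladder.Acyclic (brokenLadder l r s) := by
  induction q with
  | zero =>
    intro l r s h
    refine .leaf (r + 1, !s) (r, s) ?_ ?_ ?_ (.cone _ (l, s) ?_ ?_)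
    all_goals
      try rintro ⟨i, b⟩ hi
      simp only [brokenLadder, Set.mem_ofPred_eq, ladder_adj, away, ne_eq, Prod.mk.injEq] at *
      cases s <;> grind
  | succ q ih =>
    intro l r s h
    have h' := ih l (r - 4) s (by push_cast at h; omega)
    have e : ladder.away (ladder.away (brokenLadder l r s) (r, s)) (r - 2, !s) =
        brokenLadder l (r - 4) s := by
      ext ⟨i, b⟩
      simp only [brokenLadder, Set.mem_ofPred_eq, ladder_adj, away, ne_eq, Prod.mk.injEq]
      cases s <;> cases b <;> grind
    rw [← e] at h'
    refine .leaf (r + 1, !s) (r, s) ?_ ?_ ?_ (.leaf (r - 1, s) (r - 2, !s) ?_ ?_ ?_ h')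
    all_goals
      try rintro ⟨i, b⟩ hi
      simp only [brokenLadder, Set.mem_ofPred_eq, ladder_adj, away, ne_eq, Prod.mk.injEq] at *
      cases s <;> grind

theorem spherical_rungs (k : ℕ) :
    ladder.Spherical {p | ∃ j : ℕ, j < k ∧ p.1 = 2 * j} k := by
  induction k with
  | zero =>
    convert Spherical.empty
    ext p
    simp
  | succ k ih =>
    refine .delete _ _ (2 * k, true) ⟨k, by omega, rfl⟩ (.cone _ (2 * k, false) ?_ ?_) ?_
    · exact ⟨⟨k, by omega, rfl⟩, by simp⟩
    · rintro ⟨i, b⟩ ⟨⟨j, hj, hi⟩, hne⟩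
      simp only [ladder_adj, Set.mem_singleton_iff, Prod.mk.injEq] at *
      cases b <;> grind
    · convert ih using 1
      ext ⟨i, b⟩
      constructor
      · rintro ⟨⟨j, hj, hi⟩, hne, hadj⟩
        refine ⟨j, ?_, hi⟩
        simp only [ladder_adj, ne_eq, Prod.mk.injEq] at *
        cases b <;> grind
      · rintro ⟨j, hj, hi⟩
        refine ⟨⟨j, by omega, hi⟩, ?_⟩
        simp only [ladder_adj, ne_eq, Prod.mk.injEq] at *
        cases b <;> grind

end SimpleGraph

namespace SimpleGraph

section Cyclic

/-- Positions `0, …, N - 1` of the ladder, closed up by joining position `N - 1` to position `0`: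
crossing the seam, opposite signs are adjacent when `N` is odd and equal signs when `N` is even. -/
def cyclicLadder (N : ℕ) : SimpleGraph (ℤ × Bool) where
  Adj p q := ladder.Adj p q ∨
    ((p.1 - q.1 = N - 1 ∨ q.1 - p.1 = N - 1) ∧ (p.2 ≠ q.2 ↔ Odd N))
  symm := ⟨fun p q h => h.imp (fun h => h.symm) fun h => ⟨h.1.symm, by rw [ne_comm]; exact h.2⟩⟩
  loopless := ⟨fun p h => by
    rcases h with h | ⟨h, h'⟩
    · exact h.ne rfl
    · have hN : N = 1 := by omega
      exact h'.2 (hN ▸ odd_one) rfl⟩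

theorem cyclicLadder_adj (N : ℕ) (p q : ℤ × Bool) :
    (cyclicLadder N).Adj p q ↔ (p.2 ≠ q.2 ∧ p.1 ≤ q.1 + 1 ∧ q.1 ≤ p.1 + 1) ∨
      ((p.1 - q.1 = N - 1 ∨ q.1 - p.1 = N - 1) ∧ (p.2 ≠ q.2 ↔ Odd N)) := Iff.rfl

/-- The vertices of the ladder at positions `0, …, N - 1`. -/
def window (N : ℕ) : Set (ℤ × Bool) := {p | 0 ≤ p.1 ∧ p.1 ≤ N - 1}

theorem inducesOn_cyclicLadder {N : ℕ} {S : Set (ℤ × Bool)}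
    (hS : ∀ p ∈ S, ∀ q ∈ S, p.1 - q.1 = N - 1 → Odd N ∧ p.2 = q.2) :
    InducesOn ladder (cyclicLadder N) id S := by
  refine ⟨Set.injOn_id S, fun p hp q hq => ⟨?_, .inl⟩⟩
  rintro (h | ⟨h | h, h'⟩)
  · exact h
  · have := hS p hp q hq h
    tauto
  · have := hS q hq p hp h
    exact absurd this.2.symm (h'.2 this.1)

/-- The part of the window outside the closed neighbourhood of `(0, s)` in the cyclic ladder. -/
def cut (N : ℕ) (s : Bool) : Set (ℤ × Bool) :=
  {p | (p.1 = 1 ∧ p.2 = s) ∨ (2 ≤ p.1 ∧ p.1 ≤ N - 2) ∨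
    (2 ≤ p.1 ∧ p.1 = N - 1 ∧ (p.2 = s ↔ Odd N))}

theorem leray_window {N d : ℕ} (hN : 2 ≤ N) (hd : N / 2 ≤ d + 1)
    (h : ∀ s, ladder.Leray (cut N s) d) : (cyclicLadder N).Leray (window N) (d + 1) := by
  have h₁ : (cyclicLadder N).Leray {p : ℤ × Bool | 1 ≤ p.1 ∧ p.1 ≤ N - 1} (d + 1) := by
    have := (((leray_pendantLadder (N - 1) 1 (N - 1) true (by omega)).mono
      (T := {p : ℤ × Bool | 1 ≤ p.1 ∧ p.1 ≤ N - 1}) (fun p hp => .inl hp) le_rfl)).image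
      (G' := cyclicLadder N) (inducesOn_cyclicLadder ?_)
    · rw [Set.image_id] at this
      exact this.mono subset_rfl (by omega)
    · rintro p ⟨hp, hp'⟩ q ⟨hq, hq'⟩ hpq
      omega
  have h₂ : ∀ s, (cyclicLadder N).Leray ((cyclicLadder N).away (window N) (0, s)) d := by
    intro s
    have := (h s).image (G' := cyclicLadder N) (inducesOn_cyclicLadder ?_)
    · rw [Set.image_id] at this
      refine this.mono ?_ le_rfl
      rintro ⟨i, b⟩ hi
      simp only [window, cut, Set.mem_ofPred_eq, cyclicLadder_adj, away, ne_eq,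
        Prod.mk.injEq] at hi ⊢
      clear this h h₁
      cases s <;> cases b <;> grind
    · rintro ⟨i, b⟩ hi ⟨j, b'⟩ hj hij
      simp only [cut, Set.mem_ofPred_eq] at hi hj hij
      omega
  refine .delete _ _ (0, true) (.delete _ _ (0, false) (h₁.mono ?_ le_rfl)
    ((h₂ false).mono ?_ le_rfl)) (h₂ true)
  · rintro ⟨i, b⟩ hi
    simp only [window, Set.mem_ofPred_eq, Set.mem_sdiff, Set.mem_singleton_iff,
      Prod.mk.injEq] at hi ⊢
    cases b <;> grind
  · exact fun p hp => ⟨hp.1.1, hp.2⟩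

theorem leray_window_of_le {N d : ℕ} (hN : 2 ≤ N) (hd : N / 2 ≤ d) (hd' : (N - 1) / 2 + 1 ≤ d) :
    (cyclicLadder N).Leray (window N) d := by
  obtain ⟨d, rfl⟩ : ∃ e, d = e + 1 := ⟨d - 1, by omega⟩
  refine leray_window hN hd fun s =>
    (leray_pendantLadder (N - 2) 2 (N - 1) s (by omega)).mono ?_ (by omega)
  rintro ⟨i, b⟩ hi
  simp only [cut, pendantLadder, Set.mem_ofPred_eq] at hi ⊢
  grind

theorem leray_window_four_mul_add_three (q : ℕ) :
    (cyclicLadder (4 * q + 3)).Leray (window (4 * q + 3)) (2 * q + 1) := by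
  refine leray_window (by omega) (by omega) fun s =>
    (leray_fence q 2 (4 * q + 1) s (by omega)).mono ?_ le_rfl
  have hodd : Odd (4 * q + 3) := ⟨2 * q + 1, by ring⟩
  rintro ⟨i, b⟩ hi
  simp only [cut, fence, Set.mem_ofPred_eq, hodd, iff_true] at hi ⊢
  push_cast at hi
  grind

theorem exists_spherical_window {N k : ℕ} (h : 2 * k ≤ N) :
    ∃ S ⊆ window N, (cyclicLadder N).Spherical S k := by
  refine ⟨{p | ∃ j : ℕ, j < k ∧ p.1 = 2 * j}, ?_, ?_⟩
  · rintro p ⟨j, hj, hp⟩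
    simp only [window, Set.mem_ofPred_eq]
    omega
  · have := (spherical_rungs k).image (G' := cyclicLadder N) (inducesOn_cyclicLadder ?_)
    · rwa [Set.image_id] at this
    · rintro p ⟨i, hi, hp⟩ q ⟨j, hj, hq⟩ hpq
      omega

theorem spherical_window (q : ℕ) :
    (cyclicLadder (4 * q + 5)).Spherical (window (4 * q + 5)) (2 * q + 3) := by
  have hodd : Odd (4 * q + 5) := ⟨2 * q + 2, by ring⟩
  refine .delete _ _ (0, false) (by simp [window]; omega)
    (.delete _ (4 * q + 4, false) ?_ ?_) ?_
  · have := (acyclic_finiteFence (q + 1) 1 (4 * q + 3) true (by push_cast; ring)).image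
      (G' := cyclicLadder (4 * q + 5)) (inducesOn_cyclicLadder ?_)
    · rw [Set.image_id] at this
      convert this using 1
      ext ⟨i, b⟩
      simp only [window, finiteFence, Set.mem_ofPred_eq, Set.mem_sdiff, Set.mem_singleton_iff,
        Prod.mk.injEq]
      push_cast
      cases b <;> grind
    · rintro ⟨i, b⟩ hi ⟨j, b'⟩ hj hij
      simp only [finiteFence, Set.mem_ofPred_eq] at hi hj hij ⊢
      push_cast at hij
      refine ⟨hodd, ?_⟩
      cases b <;> cases b' <;> grind
  · have := (acyclic_brokenLadder q 1 (4 * q + 2) true (by ring)).image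
      (G' := cyclicLadder (4 * q + 5)) (inducesOn_cyclicLadder ?_)
    · rw [Set.image_id] at this
      convert this using 1
      ext ⟨i, b⟩
      simp only [window, brokenLadder, Set.mem_ofPred_eq, Set.mem_sdiff, Set.mem_singleton_iff,
        Prod.mk.injEq, away, cyclicLadder_adj, hodd, iff_true]
      push_cast
      cases b <;> grind
    · rintro ⟨i, b⟩ hi ⟨j, b'⟩ hj hij
      simp only [brokenLadder, Set.mem_ofPred_eq] at hi hj hij ⊢
      push_cast at hij
      omega
  · have := (spherical_finiteFence (q + 1) 2 (4 * q + 3) false (by push_cast; ring)).image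
      (G' := cyclicLadder (4 * q + 5)) (inducesOn_cyclicLadder ?_)
    · rw [Set.image_id, mul_add, mul_one] at this
      convert this using 1
      ext ⟨i, b⟩
      simp only [window, finiteFence, Set.mem_ofPred_eq, away, cyclicLadder_adj, hodd, iff_true]
      push_cast
      cases b <;> grind
    · rintro ⟨i, b⟩ hi ⟨j, b'⟩ hj hij
      simp only [finiteFence, Set.mem_ofPred_eq] at hi hj hij ⊢
      push_cast at hij
      omega

end Cyclic

theorem Leray.iUnion {V : Type*} {G : SimpleGraph V} {S : ℕ → Set V} {d t : ℕ}
    (hS : ∀ c < t, G.Leray (S c) d)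
    (hG : ∀ c < t, ∀ c' < t, c ≠ c' → ∀ u ∈ S c, ∀ v ∈ S c', ¬ G.Adj u v) :
    G.Leray {x | ∃ c < t, x ∈ S c} (t * d) := by
  induction t with
  | zero => exact .edgeless _ _ fun u ⟨c, hc, _⟩ => absurd hc (by omega)
  | succ t ih =>
    have := (ih (fun c hc => hS c (by omega)) fun c hc c' hc' => hG c (by omega) c' (by omega)).union
      (hS t (by omega)) fun u ⟨c, hc, hu⟩ => hG c (by omega) t (by omega) (by omega) u hu
    refine this.mono ?_ (by rw [add_mul, one_mul])
    rintro x ⟨c, hc, hx⟩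
    rcases (Nat.lt_succ_iff_lt_or_eq.1 hc) with h | rfl
    · exact .inl ⟨c, h, hx⟩
    · exact .inr hx

theorem Spherical.iUnion {V : Type*} {G : SimpleGraph V} {S : ℕ → Set V} {d t : ℕ}
    (hS : ∀ c < t, G.Spherical (S c) d)
    (hG : ∀ c < t, ∀ c' < t, c ≠ c' → ∀ u ∈ S c, ∀ v ∈ S c', ¬ G.Adj u v ∧ u ≠ v) :
    G.Spherical {x | ∃ c < t, x ∈ S c} (t * d) := by
  induction t with
  | zero =>
    convert Spherical.empty
    · simp
    · simp
  | succ t ih =>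
    have := (ih (fun c hc => hS c (by omega)) fun c hc c' hc' => hG c (by omega) c' (by omega)).union
      (hS t (by omega))
      (fun u ⟨c, hc, hu⟩ v hv => (hG c (by omega) t (by omega) (by omega) u hu v hv).1)
      (Set.disjoint_left.2 fun u ⟨c, hc, hu⟩ hv =>
        (hG c (by omega) t (by omega) (by omega) u hu u hv).2 rfl)
    convert this using 1
    · ext x
      simp only [Set.mem_ofPred_eq, Set.mem_union, Nat.lt_succ_iff_lt_or_eq, or_and_right,
        exists_or, exists_eq_left]
    · ring

end SimpleGraph

section Circulant

open SimpleGraph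

/-- The vertex of the cubic circulant graph on `2n` vertices with jump `a` reached from the
vertex `c` by `i` steps of length `a` and `i + s` steps of length `n`. -/
def circulantVertex (n a c : ℕ) (p : ℤ × Bool) : ZMod (2 * n) :=
  ((c + a * p.1 + n * (p.1 + p.2.toNat) : ℤ) : ZMod (2 * n))

variable {t N b : ℕ}

theorem two_mul_dvd_iff (hN : N ≠ 0) (hb : Odd b) (hbN : b.Coprime N) (x y : ℤ) :
    (2 * N : ℤ) ∣ b * x + N * y ↔ ∃ q : ℤ, x = q * N ∧ Even (q + y) := by
  have hN' : (N : ℤ) ≠ 0 := by exact_mod_cast hN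
  have key (q : ℤ) : (2 * N : ℤ) ∣ b * (q * N) + N * y ↔ Even (q + y) := by
    rw [show (b * (q * N) + N * y : ℤ) = (b * q + y) * N by ring,
      mul_dvd_mul_iff_right hN', ← even_iff_two_dvd, Int.even_add, Int.even_add, Int.even_mul]
    have : ¬ Even (b : ℤ) := by exact_mod_cast Nat.not_even_iff_odd.2 hb
    tauto
  constructor
  · intro h
    have h₁ : (N : ℤ) ∣ b * x :=
      (Int.dvd_add_left (Dvd.intro _ rfl)).1 ((Dvd.intro_left 2 rfl).trans h)
    obtain ⟨q, rfl⟩ := (Nat.isCoprime_iff_coprime.2 hbN).symm.dvd_of_dvd_mul_left h₁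
    exact ⟨q, mul_comm _ _, (key q).1 (by rwa [mul_comm q])⟩
  · rintro ⟨q, rfl, hq⟩
    exact (key q).2 hq

theorem circulantVertex_sub_eq_iff (hN : N ≠ 0) (hb : Odd b) (hbN : b.Coprime N) {c c' : ℕ}
    (hc : c < t) (hc' : c' < t) (p p' : ℤ × Bool) (x y : ℤ) :
    circulantVertex (t * N) (t * b) c p - circulantVertex (t * N) (t * b) c' p' =
        ((t * b : ℕ) * x + (t * N : ℕ) * y : ℤ) ↔
      c = c' ∧ ∃ q : ℤ, p.1 - p'.1 - x = q * N ∧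
        Even (q + (p.1 - p'.1 + p.2.toNat - p'.2.toNat - y)) := by
  have ht : (t : ℤ) ≠ 0 := by omega
  rw [eq_comm, circulantVertex, circulantVertex, ← Int.cast_sub, ZMod.intCast_eq_intCast_iff_dvd_sub,
    ← two_mul_dvd_iff hN hb hbN]
  have e : (c + (t * b : ℕ) * p.1 + (t * N : ℕ) * (p.1 + p.2.toNat) -
      (c' + (t * b : ℕ) * p'.1 + (t * N : ℕ) * (p'.1 + p'.2.toNat)) -
      ((t * b : ℕ) * x + (t * N : ℕ) * y) : ℤ) = (c - c' : ℤ) + t * (b * (p.1 - p'.1 - x) +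
        N * (p.1 - p'.1 + p.2.toNat - p'.2.toNat - y)) := by
    push_cast
    ring
  have e' : ((2 * (t * N) : ℕ) : ℤ) = t * (2 * N) := by
    push_cast
    ring
  rw [e, e']
  constructor
  · intro h
    have h₁ : (t : ℤ) ∣ c - c' := (Int.dvd_add_left (Dvd.intro _ rfl)).1 ((Dvd.intro _ rfl).trans h)
    have h₂ : (c - c' : ℤ) = 0 := Int.eq_zero_of_abs_lt_dvd h₁ (by rw [abs_lt]; omega)
    rw [h₂, zero_add, mul_dvd_mul_iff_left ht] at h
    exact ⟨by omega, h⟩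
  · rintro ⟨rfl, h⟩
    rw [sub_self, zero_add, mul_dvd_mul_iff_left ht]
    exact h

theorem circulantVertex_eq_iff (hN : N ≠ 0) (hb : Odd b) (hbN : b.Coprime N) {c c' : ℕ}
    (hc : c < t) (hc' : c' < t) (p p' : ℤ × Bool) :
    circulantVertex (t * N) (t * b) c p = circulantVertex (t * N) (t * b) c' p' ↔
      c = c' ∧ ∃ q : ℤ, p.1 - p'.1 = q * N ∧
        Even (q + (p.1 - p'.1 + p.2.toNat - p'.2.toNat)) := by
  simpa [sub_eq_zero] using circulantVertex_sub_eq_iff hN hb hbN hc hc' p p' 0 0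

theorem circulant_adj_iff {n a : ℕ} (ha : 0 < a) (han : a < n) (x y : ZMod (2 * n)) :
    (circulant (2 * n) {a, n}).Adj x y ↔
      x - y = (a : ZMod (2 * n)) ∨ y - x = (a : ZMod (2 * n)) ∨ x - y = (n : ZMod (2 * n)) := by
  have hne {m : ℕ} (h0 : 0 < m) (hm : m ≤ n) : (m : ZMod (2 * n)) ≠ 0 := by
    rw [Ne, ZMod.natCast_eq_zero_iff]
    exact fun h => absurd (Nat.le_of_dvd h0 h) (by omega)
  have hsymm : y - x = (n : ZMod (2 * n)) ↔ x - y = (n : ZMod (2 * n)) := by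
    have h2 : (n : ZMod (2 * n)) = -n := by
      rw [eq_neg_iff_add_eq_zero, ← two_mul]
      exact_mod_cast ZMod.natCast_self (2 * n)
    rw [← neg_sub, neg_eq_iff_eq_neg, ← h2]
  have hxy : x - y = (a : ZMod (2 * n)) ∨ y - x = (a : ZMod (2 * n)) ∨
      x - y = (n : ZMod (2 * n)) → x ≠ y := by
    rintro h rfl
    rw [sub_self] at h
    rcases h with h | h | h
    · exact hne ha han.le h.symm
    · exact hne ha han.le h.symm
    · exact hne (by omega) le_rfl h.symm
  simp only [circulant, fromRel_adj, Set.mem_insert_iff, Set.mem_singleton_iff,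
    exists_eq_or_imp, exists_eq_left]
  tauto

theorem circulant_adj_circulantVertex_iff (hN : N ≠ 0) (hb : Odd b) (hb' : b < N)
    (hbN : b.Coprime N) {c c' : ℕ} (hc : c < t) (hc' : c' < t) (p p' : ℤ × Bool) :
    (circulant (2 * (t * N)) {t * b, t * N}).Adj (circulantVertex (t * N) (t * b) c p)
        (circulantVertex (t * N) (t * b) c' p') ↔
      c = c' ∧ ∃ δ q : ℤ, -1 ≤ δ ∧ δ ≤ 1 ∧ p.1 - p'.1 = δ + q * N ∧
        Odd (q + q * N + p.2.toNat - p'.2.toNat) := by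
  have h₁ := circulantVertex_sub_eq_iff hN hb hbN hc hc' p p' 1 0
  have h₂ := circulantVertex_sub_eq_iff hN hb hbN hc' hc p' p 1 0
  have h₃ := circulantVertex_sub_eq_iff hN hb hbN hc hc' p p' 0 1
  simp only [mul_one, mul_zero, add_zero, zero_add, Int.cast_natCast, sub_zero] at h₁ h₂ h₃
  rw [circulant_adj_iff (Nat.mul_pos (by omega) hb.pos)
    (Nat.mul_lt_mul_of_pos_left hb' (by omega)), h₁, h₂, h₃]
  constructor
  · rintro (⟨rfl, q, hq, h⟩ | ⟨rfl, q, hq, h⟩ | ⟨rfl, q, hq, h⟩)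
    · refine ⟨rfl, 1, q, by norm_num, by norm_num, by linarith, ?_⟩
      grind
    · refine ⟨rfl, -1, -q, by norm_num, by norm_num, by linarith, ?_⟩
      grind
    · refine ⟨rfl, 0, q, by norm_num, by norm_num, by linarith, ?_⟩
      grind
  · rintro ⟨rfl, δ, q, h0, h1, hq, h⟩
    obtain rfl | rfl | rfl : δ = 1 ∨ δ = -1 ∨ δ = 0 := by omega
    · refine .inl ⟨rfl, q, by linarith, ?_⟩
      grind
    · refine .inr (.inl ⟨rfl, -q, by linarith, ?_⟩)
      grind
    · refine .inr (.inr ⟨rfl, q, by linarith, ?_⟩)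
      grind

theorem inducesOn_circulantVertex (hN : 2 ≤ N) (hb : Odd b) (hb' : b < N)
    (hbN : b.Coprime N) {c : ℕ} (hc : c < t) :
    InducesOn (cyclicLadder N) (circulant (2 * (t * N)) {t * b, t * N})
      (circulantVertex (t * N) (t * b) c) (window N) := by
  have small {q x : ℤ} (h : x = q * N) (h₀ : -N ≤ x) (h₁ : x ≤ N) : q = 0 ∨ q = 1 ∨ q = -1 := by
    have : q ≤ 1 := by nlinarith
    have : -1 ≤ q := by nlinarith
    omega
  refine ⟨?_, ?_⟩
  · rintro ⟨i, s⟩ hi ⟨j, s'⟩ hj h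
    rw [circulantVertex_eq_iff (by omega) hb hbN hc hc] at h
    obtain ⟨-, q, hq, he⟩ := h
    simp only [window, Set.mem_ofPred_eq] at hi hj hq he
    obtain rfl | rfl | rfl := small hq (by omega) (by omega)
    · have : i = j := by omega
      subst this
      cases s <;> cases s' <;> simp_all
    · omega
    · omega
  · rintro ⟨i, s⟩ hi ⟨j, s'⟩ hj
    rw [circulant_adj_circulantVertex_iff (by omega) hb hb' hbN hc hc, cyclicLadder_adj]
    simp only [window, Set.mem_ofPred_eq, true_and] at hi hj ⊢
    have hodd : Odd N ↔ Odd (N : ℤ) := by exact_mod_cast Iff.rfl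
    rw [hodd]
    constructor
    · rintro ⟨δ, q, h0, h1, hq, h⟩
      obtain rfl | rfl | rfl := small (q := q) (x := i - j - δ) (by linarith) (by omega) (by omega)
      · left
        refine ⟨?_, by omega, by omega⟩
        rintro rfl
        simp at h
      · right
        refine ⟨by omega, ?_⟩
        cases s <;> cases s' <;> simp at h ⊢ <;> grind
      · right
        refine ⟨by omega, ?_⟩
        cases s <;> cases s' <;> simp at h ⊢ <;> grind
    · rintro (⟨hs, h0, h1⟩ | ⟨h | h, h'⟩)
      · refine ⟨i - j, 0, by omega, by omega, by ring, ?_⟩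
        cases s <;> cases s' <;> simp at hs ⊢
      · refine ⟨-1, 1, by omega, by omega, by linarith, ?_⟩
        cases s <;> cases s' <;> simp at h' ⊢ <;> grind
      · refine ⟨1, -1, by omega, by omega, by linarith, ?_⟩
        cases s <;> cases s' <;> simp at h' ⊢ <;> grind

theorem exists_circulantVertex_eq (hN : 2 ≤ N) (hbN : b.Coprime N) (ht : 0 < t)
    (x : ZMod (2 * (t * N))) :
    ∃ c < t, x ∈ circulantVertex (t * N) (t * b) c '' window N := by
  obtain ⟨z, rfl⟩ := ZMod.intCast_surjective x
  have ht' : (0 : ℤ) < t := by exact_mod_cast ht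
  have hN' : (0 : ℤ) < N := by omega
  have h0 := Int.emod_nonneg z ht'.ne'
  have h1 := Int.emod_lt_of_pos z ht'
  obtain ⟨c, hc⟩ := Int.eq_ofNat_of_zero_le h0
  obtain ⟨u, v, huv⟩ := Nat.isCoprime_iff_coprime.2 hbN
  set i : ℤ := z / t * u with hi
  set e : ℤ := z / t * v + b * (i / N) with he
  obtain ⟨s, hs⟩ : ∃ s : Bool, Even (i % N + s.toNat - e) := by
    rcases Int.even_or_odd (i % N - e) with h | h
    · exact ⟨false, by simpa using h⟩
    · exact ⟨true, by
        rw [show (i % N + (true.toNat : ℕ) - e : ℤ) = i % N - e + 1 by simp; ring]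
        exact h.add_one⟩
  refine ⟨c, by omega, (i % N, s), ⟨Int.emod_nonneg _ hN'.ne', ?_⟩, ?_⟩
  · have := Int.emod_lt_of_pos i hN'
    simp only
    omega
  · rw [circulantVertex, eq_comm, ZMod.intCast_eq_intCast_iff_dvd_sub]
    obtain ⟨w, hw⟩ := hs
    refine ⟨w, ?_⟩
    have hz := Int.emod_add_mul_ediv z t
    have hi' := Int.emod_add_mul_ediv i N
    push_cast
    have : (i % N + s.toNat : ℤ) = w + w + e := by linarith
    rw [this, ← hc]
    linear_combination hz + (t * b : ℤ) * hi' + (t * (z / t) : ℤ) * huv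

theorem leray_circulant (hN : 2 ≤ N) (hb : Odd b) (hb' : b < N) (hbN : b.Coprime N)
    (ht : 0 < t) {d : ℕ} (h : (cyclicLadder N).Leray (window N) d) :
    (circulant (2 * (t * N)) {t * b, t * N}).Leray Set.univ (t * d) := by
  refine (Leray.iUnion (S := fun c => circulantVertex (t * N) (t * b) c '' window N)
    (fun c hc => h.image (inducesOn_circulantVertex hN hb hb' hbN hc)) ?_).mono
    (fun x _ => exists_circulantVertex_eq hN hbN ht x) le_rfl
  rintro c hc c' hc' hcc' _ ⟨p, -, rfl⟩ _ ⟨p', -, rfl⟩ hadj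
  exact hcc' ((circulant_adj_circulantVertex_iff (by omega) hb hb' hbN hc hc' p p').1 hadj).1

theorem spherical_circulant (hN : 2 ≤ N) (hb : Odd b) (hb' : b < N) (hbN : b.Coprime N)
    {d : ℕ} {S : Set (ℤ × Bool)} (hS : S ⊆ window N) (h : (cyclicLadder N).Spherical S d) :
    ∃ T, (circulant (2 * (t * N)) {t * b, t * N}).Spherical T (t * d) := by
  refine ⟨_, Spherical.iUnion (S := fun c => circulantVertex (t * N) (t * b) c '' S)
    (fun c hc => h.image ((inducesOn_circulantVertex hN hb hb' hbN hc).mono hS)) ?_⟩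
  rintro c hc c' hc' hcc' _ ⟨p, -, rfl⟩ _ ⟨p', -, rfl⟩
  exact ⟨fun hadj =>
    hcc' ((circulant_adj_circulantVertex_iff (by omega) hb hb' hbN hc hc' p p').1 hadj).1,
    fun heq => hcc' ((circulantVertex_eq_iff (by omega) hb hbN hc hc' p p').1 heq).1⟩

end Circulant

/-- **Theorem 4.7(a).**
Let `1 ≤ a < n` and `t = gcd(2n, a)`, and suppose `2n/t` is even.  Then the
edge ideal of the cubic circulant graph `C_{2n}(a, n)` satisfies
`reg(I(C_{2n}(a, n))) = kt + 1` if `n/t = 2k`, or if `n/t = 2k + 1` with `k`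
odd; and `reg(I(C_{2n}(a, n))) = (k+1)t + 1` if `n/t = 2k + 1` with `k`
even. -/
theorem regularity_cubic_circulant_even_case
    (K : Type*) [Field K] (n a : ℕ) [NeZero n]
    (ha1 : 1 ≤ a) (ha2 : a < n)
    (t : ℕ) (ht : t = Nat.gcd (2 * n) a) (heven : Even (2 * n / t)) :
    (∀ k : ℕ, (n / t = 2 * k ∨ (n / t = 2 * k + 1 ∧ Odd k)) →
      regEdgeIdeal K (circulant (2 * n) {a, n}) = k * t + 1) ∧
    (∀ k : ℕ, n / t = 2 * k + 1 → Even k →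
      regEdgeIdeal K (circulant (2 * n) {a, n}) = (k + 1) * t + 1) := by
  have ht0 : 0 < t := ht ▸ Nat.gcd_pos_of_pos_right _ ha1
  obtain ⟨b, hab⟩ : t ∣ a := ht ▸ Nat.gcd_dvd_right _ _
  obtain ⟨N, hnN⟩ : ∃ N, n = t * N := by
    obtain ⟨M, hM⟩ : t ∣ 2 * n := ht ▸ Nat.gcd_dvd_left _ _
    rw [hM, Nat.mul_div_cancel_left _ ht0] at heven
    obtain ⟨N, rfl⟩ := heven
    exact ⟨N, by linarith⟩
  have hco : Nat.Coprime (2 * N) b := by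
    rw [hab, hnN, mul_left_comm, Nat.gcd_mul_left] at ht
    exact Nat.eq_of_mul_eq_mul_left ht0 (by linarith)
  have hb : Odd b := Nat.coprime_two_left.1 hco.coprime_mul_right
  have hbN : b.Coprime N := hco.coprime_mul_left.symm
  have hbN' : b < N := Nat.lt_of_mul_lt_mul_left (hab ▸ hnN ▸ ha2)
  have hN : 2 ≤ N := by
    have := hb.pos
    omega
  have hreg {d : ℕ} {S : Set (ℤ × Bool)} (hd : 1 ≤ d)
      (h₁ : (SimpleGraph.cyclicLadder N).Leray (SimpleGraph.window N) d)
      (hS : S ⊆ SimpleGraph.window N) (h₂ : (SimpleGraph.cyclicLadder N).Spherical S d) :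
      regEdgeIdeal K (circulant (2 * n) {a, n}) = d * t + 1 := by
    have h₁' := leray_circulant hN hb hbN' hbN ht0 h₁
    obtain ⟨T, hT⟩ := spherical_circulant (t := t) hN hb hbN' hbN hS h₂
    rw [mul_comm d]
    subst hab hnN
    exact SimpleGraph.regEdgeIdeal_eq_of_certificates K (Nat.mul_pos ht0 hd) h₁' hT
  have hdiv : n / t = N := by rw [hnN, Nat.mul_div_cancel_left _ ht0]
  rw [hdiv]
  refine ⟨fun k hk => ?_, fun k hk hk' => ?_⟩
  · obtain ⟨S, hS, hS'⟩ := SimpleGraph.exists_spherical_window (N := N) (k := k) (by omega)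
    refine hreg (by omega) ?_ hS hS'
    rcases hk with hk | ⟨hk, q, hq⟩
    · exact SimpleGraph.leray_window_of_le hN (by omega) (by omega)
    · obtain rfl : N = 4 * q + 3 := by omega
      exact hq ▸ SimpleGraph.leray_window_four_mul_add_three q
  · obtain ⟨q, hq⟩ : ∃ q, N = 4 * q + 5 := by
      obtain ⟨m, hm⟩ := hk'
      exact ⟨m - 1, by omega⟩
    refine hreg (by omega) (SimpleGraph.leray_window_of_le hN (by omega) (by omega)) subset_rfl ?_
    obtain rfl : k = 2 * q + 2 := by omega
    subst hq
    exact SimpleGraph.spherical_window q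
end
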